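/- Let Ω ⊆ ℝ³ be an exterior domain with real-analytic boundary ∂Ω. Then there exist real-analytic vector fields X₀, T₁, T₂, T₃ defined globally on the closure of Ω such that: (1) T₁, T₂, T₃ are tangential to ∂Ω, with T_j = Σ_{i=1}^{3} b_{ij}(x) ∂_i for 1 ≤ j ≤ 3, where the coefficients satisfy |∂^α b_{ij}(x)| ≤ C^{|α|+1} |α|! for all x in the closure of Ω and all multi-indices α ∈ ℕ₀³ (constant analyticity radii); and (2) there exists η₀ > 0 and real-analytic coefficient functions ξ_k(x), η_{jk}(x) on the closed collar {x ∈ closure(Ω) : d(x) ≤ η₀} such that ∂/∂x_k = ξ_k(x) X₀ + Σ_{j=1}^{3} η_{jk}(x) T_j there, for k = 1, 2, 3. -/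

import Mathlib

open MeasureTheory Finset

noncomputable section

/-- The ambient space `ℝ³`. -/
abbrev E3 : Type := EuclideanSpace ℝ (Fin 3)

/-- Partial derivative in coordinate direction `i`. -/
def pd (i : Fin 3) (f : E3 → ℝ) : E3 → ℝ :=
  fun x => fderiv ℝ f x (EuclideanSpace.single i 1)

/-- Iterated coordinate derivatives along a list of directions. -/
def pdList : List (Fin 3) → (E3 → ℝ) → (E3 → ℝ)
  | [], f => f
  | i :: l, f => pd i (pdList l f)

/-- The `L²` norm of a scalar function on a set `Ω`. -/
def L2 (Ω : Set E3) (f : E3 → ℝ) : ℝ :=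
  Real.sqrt (∫ x in Ω, (f x) ^ 2)

/-- The `L²` norm of a vector field on a set `Ω`. -/
def L2v (Ω : Set E3) (v : E3 → Fin 3 → ℝ) : ℝ :=
  Real.sqrt (∫ x in Ω, ∑ i, (v x i) ^ 2)

/-- Sum of the `L²` norms of all coordinate derivatives of order `j`. -/
def DnormL2 (Ω : Set E3) (j : ℕ) (f : E3 → ℝ) : ℝ :=
  ∑ ι : Fin j → Fin 3, L2 Ω (pdList (List.ofFn ι) f)

/-- The Sobolev `H^m` norm (all derivatives of order at most `m` in `L²`). -/
def HnormL2 (Ω : Set E3) (m : ℕ) (f : E3 → ℝ) : ℝ :=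
  ∑ j ∈ Finset.range (m + 1), DnormL2 Ω j f

/-- Order-`j` derivative norm of a vector field. -/
def DnormL2v (Ω : Set E3) (j : ℕ) (v : E3 → Fin 3 → ℝ) : ℝ :=
  ∑ m : Fin 3, DnormL2 Ω j (fun x => v x m)

/-- Sobolev `H^m` norm of a vector field. -/
def HnormL2v (Ω : Set E3) (m : ℕ) (v : E3 → Fin 3 → ℝ) : ℝ :=
  ∑ j ∈ Finset.range (m + 1), DnormL2v Ω j v

/-- Square-integrability of all derivatives of order at most `m`
(classical-derivative rendering of membership in `H^m`). -/
def InH (Ω : Set E3) (m : ℕ) (f : E3 → ℝ) : Prop :=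
  ∀ l : List (Fin 3), l.length ≤ m → IntegrableOn (fun x => (pdList l f x) ^ 2) Ω

/-- The signed distance to the boundary of `Ω`, positive inside `Ω`. -/
def sdist (Ω : Set E3) (x : E3) : ℝ :=
  Metric.infDist x Ωᶜ - Metric.infDist x Ω

/-- The outward unit normal, extended as `ν = -∇d` via the signed distance. -/
def nuv (Ω : Set E3) (x : E3) (i : Fin 3) : ℝ := -(pd i (sdist Ω) x)

/-- The collar neighborhood `Ω_{δ₀} = {x ∈ Ω : d(x) < δ₀}` of the boundary. -/
def collar (Ω : Set E3) (δ₀ : ℝ) : Set E3 := {x ∈ Ω | sdist Ω x < δ₀}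

/-- `Ω ⊆ ℝ³` is an exterior domain: an open set lying on one side of its
nonempty compact boundary (equivalently, the complement is compact). -/
structure ExteriorDomain (Ω : Set E3) : Prop where
  isOpen : IsOpen Ω
  compl_compact : IsCompact Ωᶜ
  bdry_nonempty : (frontier Ω).Nonempty

/-- `Ω` has a real-analytic boundary: the signed distance function is
real-analytic and noncritical on a neighborhood of the boundary. -/
def AnalyticBoundary (Ω : Set E3) : Prop :=
  ∃ U : Set E3, IsOpen U ∧ frontier Ω ⊆ U ∧ AnalyticOnNhd ℝ (sdist Ω) U ∧
    ∀ x ∈ frontier Ω, ∃ i, pd i (sdist Ω) x ≠ 0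

/-- `Ω` has a smooth boundary: the signed distance function is smooth and
noncritical on a neighborhood of the boundary. -/
def SmoothBoundary (Ω : Set E3) : Prop :=
  ∃ U : Set E3, IsOpen U ∧ frontier Ω ⊆ U ∧ ContDiffOn ℝ (⊤ : ℕ∞) (sdist Ω) U ∧
    ∀ x ∈ frontier Ω, ∃ i, pd i (sdist Ω) x ≠ 0

/-- The first-order operator with coefficients `b`. -/
def vecOp (b : Fin 3 → E3 → ℝ) (f : E3 → ℝ) : E3 → ℝ :=
  fun x => ∑ i, b i x * pd i f x

/-- Iterated application of a triple of operators along a list of indices. -/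
def opList (T : Fin 3 → (E3 → ℝ) → (E3 → ℝ)) :
    List (Fin 3) → (E3 → ℝ) → (E3 → ℝ)
  | [], f => f
  | i :: l, f => T i (opList T l f)

/-- Componentwise iterated application to a vector field. -/
def opListV (T : Fin 3 → (E3 → ℝ) → (E3 → ℝ)) (β : List (Fin 3))
    (v : E3 → Fin 3 → ℝ) : E3 → Fin 3 → ℝ :=
  fun x m => opList T β (fun y => v y m) x

/-- Divergence of a vector field. -/
def div3 (v : E3 → Fin 3 → ℝ) : E3 → ℝ :=
  fun x => ∑ i, pd i (fun y => v y i) x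

/-- Curl of a vector field. -/
def curl3 (v : E3 → Fin 3 → ℝ) : E3 → Fin 3 → ℝ :=
  fun x => ![pd 1 (fun y => v y 2) x - pd 2 (fun y => v y 1) x,
             pd 2 (fun y => v y 0) x - pd 0 (fun y => v y 2) x,
             pd 0 (fun y => v y 1) x - pd 1 (fun y => v y 0) x]

/-- Gradient of a scalar function, as a vector field. -/
def grad3 (f : E3 → ℝ) : E3 → Fin 3 → ℝ := fun x i => pd i f x

/-- A complete system of tangential analytic vector fields `T₁,T₂,T₃`
(with coefficients `b j`), together with an additional analytic field `X₀`
(with coefficients `bX`), such that the `T_j` are tangential to `∂Ω`,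
the coefficients have uniform analyticity bounds on the closure of `Ω`,
and near the boundary the fields span all partial derivatives. -/
structure TangSystem (Ω : Set E3) where
  b : Fin 3 → Fin 3 → E3 → ℝ
  bX : Fin 3 → E3 → ℝ
  Cb : ℝ
  Cb_pos : 0 < Cb
  analytic_b : ∀ j i : Fin 3, ∀ l : List (Fin 3), ∀ x ∈ closure Ω,
    |pdList l (b j i) x| ≤ Cb ^ (l.length + 1) * (Nat.factorial l.length : ℝ)
  analytic_bX : ∀ i : Fin 3, ∀ l : List (Fin 3), ∀ x ∈ closure Ω,
    |pdList l (bX i) x| ≤ Cb ^ (l.length + 1) * (Nat.factorial l.length : ℝ)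
  tangential : ∀ j : Fin 3, ∀ x ∈ frontier Ω, vecOp (b j) (sdist Ω) x = 0
  η₀ : ℝ
  η₀_pos : 0 < η₀
  ξ : Fin 3 → E3 → ℝ
  ηc : Fin 3 → Fin 3 → E3 → ℝ
  span : ∀ k : Fin 3, ∀ f : E3 → ℝ, ∀ x ∈ closure Ω, sdist Ω x ≤ η₀ →
    pd k f x = ξ k x * vecOp bX f x + ∑ j, ηc j k x * vecOp (b j) f x

/-- The tangential fields of a tangential system, as operators. -/
def Tfields {Ω : Set E3} (S : TangSystem Ω) : Fin 3 → (E3 → ℝ) → (E3 → ℝ) :=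
  fun j => vecOp (S.b j)

/-- `ε` times the time derivative. -/
def tder (ε : ℝ) (f : ℝ → E3 → ℝ) : ℝ → E3 → ℝ :=
  fun t x => ε * deriv (fun s => f s x) t

/-- `(ε ∂_t)^i f` evaluated at time `t`, a spatial scalar function. -/
def st (ε : ℝ) (i : ℕ) (f : ℝ → E3 → ℝ) (t : ℝ) : E3 → ℝ :=
  (tder ε)^[i] f t

/-- `(ε ∂_t)^i v` evaluated at time `t`, a spatial vector field. -/
def vt (ε : ℝ) (i : ℕ) (v : ℝ → E3 → Fin 3 → ℝ) (t : ℝ) : E3 → Fin 3 → ℝ :=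
  fun x m => (tder ε)^[i] (fun s y => v s y m) t x

/-- The `L²` norm `‖∂_x^j T^k f‖_{L²(Ω)}` (sum over all order-`j` spatial
derivatives and all `k`-fold compositions of the tangential fields). -/
def DTnorm (Ω : Set E3) (T : Fin 3 → (E3 → ℝ) → (E3 → ℝ)) (j k : ℕ)
    (f : E3 → ℝ) : ℝ :=
  ∑ ι : Fin j → Fin 3, ∑ β : Fin k → Fin 3,
    L2 Ω (pdList (List.ofFn ι) (opList T (List.ofFn β) f))

/-- Vector-field version of `DTnorm`. -/
def DTnormV (Ω : Set E3) (T : Fin 3 → (E3 → ℝ) → (E3 → ℝ)) (j k : ℕ)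
    (w : E3 → Fin 3 → ℝ) : ℝ :=
  ∑ m : Fin 3, DTnorm Ω T j k (fun x => w x m)

/-- Sup norm on a set. -/
def supOn (s : Set E3) (f : E3 → ℝ) : ℝ := ⨆ x ∈ s, |f x|

/-- The `L^∞` norm `‖∂_x^j T^k f‖_{L^∞(s)}`. -/
def DTnormSup (s : Set E3) (T : Fin 3 → (E3 → ℝ) → (E3 → ℝ)) (j k : ℕ)
    (f : E3 → ℝ) : ℝ :=
  ∑ ι : Fin j → Fin 3, ∑ β : Fin k → Fin 3,
    supOn s (pdList (List.ofFn ι) (opList T (List.ofFn β) f))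

/-- The commutator `[T^β, div]` applied to a vector field. -/
def commDiv (T : Fin 3 → (E3 → ℝ) → (E3 → ℝ)) (β : List (Fin 3))
    (w : E3 → Fin 3 → ℝ) : E3 → ℝ :=
  fun x => opList T β (div3 w) x - div3 (opListV T β w) x

/-- The commutator `[T^β, curl]` applied to a vector field. -/
def commCurl (T : Fin 3 → (E3 → ℝ) → (E3 → ℝ)) (β : List (Fin 3))
    (w : E3 → Fin 3 → ℝ) : E3 → Fin 3 → ℝ :=
  fun x m => opList T β (fun y => curl3 w y m) x - curl3 (opListV T β w) x m

/-- The commutator `[T^β, ∇]` applied to a scalar function. -/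
def commGrad (T : Fin 3 → (E3 → ℝ) → (E3 → ℝ)) (β : List (Fin 3))
    (f : E3 → ℝ) : E3 → Fin 3 → ℝ :=
  fun x m => opList T β (pd m f) x - pd m (opList T β f) x

/-- The commutator `[T_a, ∂^ι]` applied to a scalar function. -/
def commTD (T : Fin 3 → (E3 → ℝ) → (E3 → ℝ)) (a : Fin 3) (ι : List (Fin 3))
    (f : E3 → ℝ) : E3 → ℝ :=
  fun x => T a (pdList ι f) x - pdList ι (T a f) x

/-- The commutator `[∂^ι, T_a]` applied to a scalar function. -/
def commDT (T : Fin 3 → (E3 → ℝ) → (E3 → ℝ)) (ι : List (Fin 3)) (a : Fin 3)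
    (f : E3 → ℝ) : E3 → ℝ :=
  fun x => pdList ι (T a f) x - T a (pdList ι f) x

/-- The analytic norm `‖f‖_{A(τ)}` with parameters `κ, κ̄`:
`Σ_{(j,k,i)} κ^{(j−1)₊} κ̄^k τ^{(j+k+i−3)₊}/(j+k+i−3)! ‖∂_x^j T^k (ε∂_t)^i f‖_{L²(Ω)}`
(recall `n! = 1` for `n < 0`, which is implemented by truncated subtraction). -/
def Anorm (Ω : Set E3) (T : Fin 3 → (E3 → ℝ) → (E3 → ℝ)) (ε κ κb τ : ℝ)
    (f : ℝ → E3 → ℝ) (t : ℝ) : ℝ :=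
  ∑' p : ℕ × ℕ × ℕ,
    κ ^ (p.1 - 1) * κb ^ p.2.1 * τ ^ (p.1 + p.2.1 + p.2.2 - 3) /
      (Nat.factorial (p.1 + p.2.1 + p.2.2 - 3) : ℝ) *
      DTnorm Ω T p.1 p.2.1 (st ε p.2.2 f t)

/-- The analytic norm `‖f‖_{B(τ)}`:
`Σ_{(j,k,i)} κ^j κ̄^k τ^{(j+k+i−2)₊}/(j+k+i−2)! ‖∂_x^j T^k (ε∂_t)^i f‖_{L²(Ω)}`. -/
def Bnorm (Ω : Set E3) (T : Fin 3 → (E3 → ℝ) → (E3 → ℝ)) (ε κ κb τ : ℝ)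
    (f : ℝ → E3 → ℝ) (t : ℝ) : ℝ :=
  ∑' p : ℕ × ℕ × ℕ,
    κ ^ p.1 * κb ^ p.2.1 * τ ^ (p.1 + p.2.1 + p.2.2 - 2) /
      (Nat.factorial (p.1 + p.2.1 + p.2.2 - 2) : ℝ) *
      DTnorm Ω T p.1 p.2.1 (st ε p.2.2 f t)

/-- The norm `‖f‖_Y = sup_{j+k+i ≤ 4} ‖∂_x^j T^k (ε∂_t)^i f‖_{L²(Ω)}`. -/
def Ynorm (Ω : Set E3) (T : Fin 3 → (E3 → ℝ) → (E3 → ℝ)) (ε : ℝ)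
    (f : ℝ → E3 → ℝ) (t : ℝ) : ℝ :=
  ⨆ p : ℕ × ℕ × ℕ,
    if p.1 + p.2.1 + p.2.2 ≤ 4 then DTnorm Ω T p.1 p.2.1 (st ε p.2.2 f t) else 0

/-- `A(τ)`-norm of a (time-dependent) vector field. -/
def AnormV (Ω : Set E3) (T : Fin 3 → (E3 → ℝ) → (E3 → ℝ)) (ε κ κb τ : ℝ)
    (v : ℝ → E3 → Fin 3 → ℝ) (t : ℝ) : ℝ :=
  ∑ m : Fin 3, Anorm Ω T ε κ κb τ (fun s x => v s x m) t

/-- `B(τ)`-norm of a (time-dependent) vector field. -/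
def BnormV (Ω : Set E3) (T : Fin 3 → (E3 → ℝ) → (E3 → ℝ)) (ε κ κb τ : ℝ)
    (v : ℝ → E3 → Fin 3 → ℝ) (t : ℝ) : ℝ :=
  ∑ m : Fin 3, Bnorm Ω T ε κ κb τ (fun s x => v s x m) t

/-- `Y`-norm of a (time-dependent) vector field. -/
def YnormV (Ω : Set E3) (T : Fin 3 → (E3 → ℝ) → (E3 → ℝ)) (ε : ℝ)
    (v : ℝ → E3 → Fin 3 → ℝ) (t : ℝ) : ℝ :=
  ∑ m : Fin 3, Ynorm Ω T ε (fun s x => v s x m) t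

/-- The spatial analytic norm `‖f‖_{X(δ)} = Σ_j δ^{(j−3)₊}/(j−3)! ‖∂_x^j f‖_{L²(Ω)}`. -/
def Xnorm (Ω : Set E3) (δ : ℝ) (f : E3 → ℝ) : ℝ :=
  ∑' j : ℕ, δ ^ (j - 3) / (Nat.factorial (j - 3) : ℝ) * DnormL2 Ω j f

/-- `X(δ)`-norm of a vector field. -/
def XnormV (Ω : Set E3) (δ : ℝ) (v : E3 → Fin 3 → ℝ) : ℝ :=
  ∑ m : Fin 3, Xnorm Ω δ (fun x => v x m)

/-- `(p, v, S)` is a smooth solution on `[0, T₀]` of the symmetrized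
non-isentropic compressible Euler system with Mach number `ε`,
coefficients `a = f₁(S) g₁(εu)`, `r = f₂(S) g₂(εu)`, and impermeability
boundary condition `v·ν = 0` on `∂Ω`. -/
structure EulerSol (Ω : Set E3) (ε : ℝ) (f₁ f₂ : ℝ → ℝ)
    (g₁ g₂ : ℝ → (Fin 3 → ℝ) → ℝ) (p : ℝ → E3 → ℝ)
    (v : ℝ → E3 → Fin 3 → ℝ) (S : ℝ → E3 → ℝ) (T₀ : ℝ) : Prop where
  smooth_p : ContDiff ℝ (⊤ : ℕ∞) (fun q : ℝ × E3 => p q.1 q.2)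
  smooth_v : ∀ m : Fin 3, ContDiff ℝ (⊤ : ℕ∞) (fun q : ℝ × E3 => v q.1 q.2 m)
  smooth_S : ContDiff ℝ (⊤ : ℕ∞) (fun q : ℝ × E3 => S q.1 q.2)
  eq_p : ∀ t ∈ Set.Icc (0 : ℝ) T₀, ∀ x ∈ Ω,
    f₁ (S t x) * g₁ (ε * p t x) (fun i => ε * v t x i) *
        (deriv (fun s => p s x) t + ∑ i, v t x i * pd i (p t) x) +
      ε⁻¹ * div3 (v t) x = 0
  eq_v : ∀ t ∈ Set.Icc (0 : ℝ) T₀, ∀ x ∈ Ω, ∀ m : Fin 3,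
    f₂ (S t x) * g₂ (ε * p t x) (fun i => ε * v t x i) *
        (deriv (fun s => v s x m) t + ∑ i, v t x i * pd i (fun y => v t y m) x) +
      ε⁻¹ * pd m (p t) x = 0
  eq_S : ∀ t ∈ Set.Icc (0 : ℝ) T₀, ∀ x ∈ Ω,
    deriv (fun s => S s x) t + ∑ i, v t x i * pd i (S t) x = 0
  bc : ∀ t ∈ Set.Icc (0 : ℝ) T₀, ∀ x ∈ frontier Ω,
    ∑ i, v t x i * nuv Ω x i = 0

/-- Bound `M₀` on the `H⁵` norm of the initial data. -/
def H5bound (Ω : Set E3) (M₀ : ℝ) (p₀ : E3 → ℝ) (v₀ : E3 → Fin 3 → ℝ)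
    (S₀ : E3 → ℝ) : Prop :=
  HnormL2 Ω 5 p₀ + HnormL2v Ω 5 v₀ + HnormL2 Ω 5 S₀ ≤ M₀

/-- The analytic bound on the initial data:
`Σ_j τ₀^{(j−3)₊}/(j−3)! ‖∂_x^j (p₀,v₀,S₀)‖_{L²(Ω)} ≤ M₀`. -/
def AnalyticInit (Ω : Set E3) (τ₀ M₀ : ℝ) (p₀ : E3 → ℝ)
    (v₀ : E3 → Fin 3 → ℝ) (S₀ : E3 → ℝ) : Prop :=
  ∑' j : ℕ, τ₀ ^ (j - 3) / (Nat.factorial (j - 3) : ℝ) *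
    (DnormL2 Ω j p₀ + DnormL2v Ω j v₀ + DnormL2 Ω j S₀) ≤ M₀

/-- Compatibility conditions of all orders: all time derivatives of the
velocity at `t = 0` are tangential at the boundary. -/
def CompatAll (Ω : Set E3) (v : ℝ → E3 → Fin 3 → ℝ) : Prop :=
  ∀ k : ℕ, ∀ x ∈ frontier Ω,
    ∑ i, iteratedDeriv k (fun s => v s x i) 0 * nuv Ω x i = 0

/-- `M_{ε,κ,κ̄}(t) = sup_{s∈[0,t]} (‖S(s)‖_{A(τ(s))} + ‖u(s)‖_{A(τ(s))})`
with `τ(s) = τ₀ − K s` and `u = (p, v)`. -/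
def Mnorm (Ω : Set E3) (T : Fin 3 → (E3 → ℝ) → (E3 → ℝ)) (ε κ κb τ0 K : ℝ)
    (p : ℝ → E3 → ℝ) (v : ℝ → E3 → Fin 3 → ℝ) (S : ℝ → E3 → ℝ) (t : ℝ) : ℝ :=
  ⨆ s ∈ Set.Icc (0 : ℝ) t,
    (Anorm Ω T ε κ κb (τ0 - K * s) S s + Anorm Ω T ε κ κb (τ0 - K * s) p s +
      AnormV Ω T ε κ κb (τ0 - K * s) v s)


/-- The extension of scalars of a formal power series in three real variables to a commutative
Banach algebra. -/
def extendScalars (P : FormalMultilinearSeries ℝ E3 ℝ) (A : Type) [NormedCommRing A]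
    [NormedAlgebra ℝ A] : FormalMultilinearSeries ℝ (Fin 3 → A) A := fun n =>
  ∑ i : Fin n → Fin 3, (P n fun k => EuclideanSpace.single (i k) 1) •
    (ContinuousMultilinearMap.mkPiAlgebra ℝ (Fin n) A).compContinuousLinearMap
      fun k => ContinuousLinearMap.proj (i k)

theorem extendScalars_apply (P : FormalMultilinearSeries ℝ E3 ℝ) {A : Type} [NormedCommRing A]
    [NormedAlgebra ℝ A] (n : ℕ) (a : Fin 3 → A) :
    extendScalars P A n (fun _ => a) =
      ∑ i : Fin n → Fin 3, (P n fun k => EuclideanSpace.single (i k) 1) • ∏ k, a (i k) := by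
  simp [extendScalars]

theorem abs_apply_single_le (P : FormalMultilinearSeries ℝ E3 ℝ) {n : ℕ} (i : Fin n → Fin 3) :
    |P n fun k => EuclideanSpace.single (i k) 1| ≤ ‖P n‖ := by
  simpa using (P n).le_opNorm fun k => EuclideanSpace.single (i k) (1 : ℝ)

theorem norm_extendScalars_le (P : FormalMultilinearSeries ℝ E3 ℝ) (A : Type) [NormedCommRing A]
    [NormedAlgebra ℝ A] {n : ℕ} (hn : n ≠ 0) : ‖extendScalars P A n‖ ≤ 3 ^ n * ‖P n‖ := by
  have : Nonempty (Fin n) := ⟨⟨0, Nat.pos_of_ne_zero hn⟩⟩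
  calc ‖extendScalars P A n‖ ≤ ∑ _i : Fin n → Fin 3, ‖P n‖ := by
        refine norm_sum_le_of_le _ fun i _ => ?_
        rw [norm_smul]
        refine (mul_le_mul (abs_apply_single_le P i) (?_ : _ ≤ (1 : ℝ)) (norm_nonneg _)
          (norm_nonneg _)).trans_eq (mul_one _)
        refine (ContinuousMultilinearMap.norm_compContinuousLinearMap_le _ _).trans ?_
        refine mul_le_one₀ ContinuousMultilinearMap.norm_mkPiAlgebra_le
          (Finset.prod_nonneg fun _ _ => norm_nonneg _)
          (Finset.prod_le_one (fun _ _ => norm_nonneg _) fun k _ => ?_)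
        refine ContinuousLinearMap.opNorm_le_bound _ zero_le_one fun a => ?_
        simpa using norm_le_pi_norm a (i k)
    _ = 3 ^ n * ‖P n‖ := by simp

theorem le_radius_extendScalars (P : FormalMultilinearSeries ℝ E3 ℝ) {C r : ℝ} (hr : 0 < r)
    (hP : ∀ n, ‖P n‖ ≤ C * r ^ n) (A : Type) [NormedCommRing A] [NormedAlgebra ℝ A] :
    ENNReal.ofReal (3 * r)⁻¹ ≤ (extendScalars P A).radius := by
  refine FormalMultilinearSeries.le_radius_of_eventually_le _ C ?_
  filter_upwards [Filter.eventually_ne_atTop 0] with n hn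
  rw [Real.coe_toNNReal _ (by positivity)]
  calc ‖extendScalars P A n‖ * (3 * r)⁻¹ ^ n ≤ (3 ^ n * (C * r ^ n)) * (3 * r)⁻¹ ^ n := by
        gcongr
        exact (norm_extendScalars_le P A hn).trans (by gcongr; exact hP n)
    _ = C := by
        rw [inv_pow, mul_pow]; field_simp

theorem extendScalars_real (P : FormalMultilinearSeries ℝ E3 ℝ) (n : ℕ) (y : Fin 3 → ℝ) :
    extendScalars P ℝ n (fun _ => y) = P n fun _ => WithLp.toLp 2 y := by
  have h : WithLp.toLp 2 y = ∑ j, y j • (EuclideanSpace.single j (1 : ℝ) : E3) := by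
    ext k; simp [Pi.single_apply]
  rw [extendScalars_apply, h, ContinuousMultilinearMap.map_sum]
  refine Finset.sum_congr rfl fun i _ => ?_
  rw [ContinuousMultilinearMap.map_smul_univ, smul_eq_mul, smul_eq_mul, mul_comm]

theorem differentiableOn_extendScalars_sum (P : FormalMultilinearSeries ℝ E3 ℝ) {C r : ℝ}
    (hr : 0 < r) (hP : ∀ n, ‖P n‖ ≤ C * r ^ n) {U : Set ℂ} (hU : IsOpen U) {ρ : ℝ}
    (hρ : ρ < (3 * r)⁻¹) {g : ℂ → Fin 3 → ℂ} (hg : ∀ i, DifferentiableOn ℂ (fun z => g z i) U)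
    (hgρ : ∀ z ∈ U, ‖g z‖ ≤ ρ) :
    DifferentiableOn ℂ (fun z => (extendScalars P ℂ).sum (g z)) U := by
  rcases U.eq_empty_or_nonempty with rfl | ⟨z₀, hz₀⟩
  · exact differentiableOn_empty
  have hρ0 : 0 ≤ ρ := (norm_nonneg _).trans (hgρ z₀ hz₀)
  have h3 : 3 * r * ρ < 1 := by
    calc 3 * r * ρ < 3 * r * (3 * r)⁻¹ := by gcongr
      _ = 1 := mul_inv_cancel₀ (by positivity)
  refine Complex.differentiableOn_tsum_of_summable_norm (u := fun n => C * (3 * r * ρ) ^ n)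
    ((summable_geometric_of_lt_one (by positivity) h3).mul_left C) (fun n => ?_) hU ?_
  · simp_rw [extendScalars_apply]
    exact DifferentiableOn.fun_sum fun i _ =>
      (DifferentiableOn.fun_finsetProd fun k _ => hg (i k)).const_smul
      (P n fun k => EuclideanSpace.single (i k) 1)
  · intro n z hz
    rw [extendScalars_apply]
    calc _ ≤ ∑ _i : Fin n → Fin 3, C * r ^ n * ρ ^ n := by
          refine norm_sum_le_of_le _ fun i _ => ?_
          rw [norm_smul, norm_prod]
          refine mul_le_mul ((abs_apply_single_le P i).trans (hP n)) ?_ (by positivity)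
            ((norm_nonneg _).trans (hP n))
          refine (Finset.prod_le_prod (fun _ _ => norm_nonneg _) fun k _ =>
            (norm_le_pi_norm (g z) (i k)).trans (hgρ z hz)).trans_eq (by simp)
      _ = C * (3 * r * ρ) ^ n := by simp; ring

/-- The real function `f` of three real variables acts, in a natural way, on the triples of elements
of commutative Banach algebras at distance less than `ε` from the scalar triple `p`. -/
def HasFunctionalCalculus (f : E3 → ℝ) (p : E3) (ε : ℝ) : Prop :=
  ∃ F : ∀ (A : Type) [NormedCommRing A] [NormedAlgebra ℝ A], (Fin 3 → A) → A,
    (∀ (A : Type) [NormedCommRing A] [NormedAlgebra ℝ A] [CompleteSpace A] [NormOneClass A]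
      (a : Fin 3 → A), ‖a - fun i => algebraMap ℝ A (p i)‖ < ε → AnalyticAt ℝ (F A) a) ∧
    (∀ (A B : Type) [NormedCommRing A] [NormedAlgebra ℝ A] [CompleteSpace A] [NormOneClass A]
      [NormedCommRing B] [NormedAlgebra ℝ B] (χ : A →A[ℝ] B) (a : Fin 3 → A),
      ‖a - fun i => algebraMap ℝ A (p i)‖ < ε → χ (F A a) = F B fun i => χ (a i)) ∧
    (∀ y : Fin 3 → ℝ, ‖y - fun i => p i‖ < ε → F ℝ y = f (WithLp.toLp 2 y)) ∧
    ∀ (U : Set ℂ) (g : ℂ → Fin 3 → ℂ), IsOpen U → (∀ i, DifferentiableOn ℂ (fun z => g z i) U) →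
      (∀ z ∈ U, ‖g z - fun i => (p i : ℂ)‖ < ε) → DifferentiableOn ℂ (fun z => F ℂ (g z)) U

theorem AnalyticAt.exists_hasFunctionalCalculus {f : E3 → ℝ} {p : E3} (hf : AnalyticAt ℝ f p) :
    ∃ ε > 0, HasFunctionalCalculus f p ε := by
  obtain ⟨P, R, hR⟩ := hf
  obtain ⟨C, r, hC, hr, hP⟩ := P.le_mul_pow_of_radius_pos (hR.r_pos.trans_le hR.r_le)
  obtain ⟨δ, hδ, hδR⟩ : ∃ δ : ℝ, 0 < δ ∧ ∀ y : Fin 3 → ℝ, ‖y‖ < δ →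
      WithLp.toLp 2 y ∈ Metric.eball (0 : E3) R := by
    have := (PiLp.continuous_toLp 2 (fun _ : Fin 3 => ℝ)).continuousAt (x := 0)
    have h2 := this.preimage_mem_nhds (by
      simpa using Metric.eball_mem_nhds (0 : E3) hR.r_pos)
    obtain ⟨δ, hδ, h⟩ := Metric.mem_nhds_iff.1 h2
    exact ⟨δ, hδ, fun y hy => h (by simpa using hy)⟩
  have hε : 0 < min δ ((3 * r)⁻¹ / 2) := by positivity
  have hball : ∀ (A : Type) [NormedCommRing A] [NormedAlgebra ℝ A] (a : Fin 3 → A),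
      ‖a‖ < min δ ((3 * r)⁻¹ / 2) → a ∈ Metric.eball 0 (extendScalars P A).radius := by
    intro A _ _ a ha
    refine Metric.eball_subset_eball (le_radius_extendScalars P hr hP A) ?_
    rw [Metric.eball_ofReal, mem_ball_zero_iff]
    exact ha.trans_le ((min_le_right _ _).trans (half_le_self (by positivity)))
  refine ⟨_, hε, fun A _ _ a => (extendScalars P A).sum (a - fun i => algebraMap ℝ A (p i)),
    ?_, ?_, ?_, ?_⟩
  · intro A _ _ _ _ a ha
    have h0 : 0 < (extendScalars P A).radius :=
      lt_of_lt_of_le (by simpa using hr) (le_radius_extendScalars P hr hP A)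
    have h1 := ((extendScalars P A).hasFPowerSeriesOnBall h0).analyticAt_of_mem (hball A _ ha)
    exact h1.comp_of_eq (analyticAt_id.sub analyticAt_const) rfl
  · intro A B _ _ _ _ _ _ χ a ha
    have hs := (extendScalars P A).summable (hball A _ ha)
    have := χ.toContinuousLinearMap.map_tsum hs
    refine Eq.trans this (tsum_congr fun n => ?_)
    rw [extendScalars_apply, extendScalars_apply]
    simp only [ContinuousAlgHom.coe_toContinuousLinearMap]
    have hχ : ∀ t : ℝ, χ (algebraMap ℝ A t) = algebraMap ℝ B t := fun t => AlgHomClass.commutes χ t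
    simp [map_sum, map_prod, hχ]
  · intro y hy
    have h := hR.sum (hδR _ (hy.trans_le (min_le_left _ _)))
    have e : p + WithLp.toLp 2 (y - fun i => p i) = WithLp.toLp 2 y := by ext; simp
    rw [e] at h
    rw [h]
    exact tsum_congr fun n => extendScalars_real P n _
  · intro U g hU hg hgε
    refine differentiableOn_extendScalars_sum P hr hP hU (ρ := (3 * r)⁻¹ / 2)
      (half_lt_self (by positivity)) (fun i => ?_) fun z hz => ?_
    · exact (hg i).sub_const _
    · exact (hgε z hz).le.trans (min_le_right _ _)

theorem HasFunctionalCalculus.mono {f : E3 → ℝ} {p q : E3} {ε δ : ℝ}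
    (h : HasFunctionalCalculus f p ε) (hδ : ‖(fun i => q i) - fun i => p i‖ + δ ≤ ε) :
    HasFunctionalCalculus f q δ := by
  obtain ⟨F, h1, h2, h3, h4⟩ := h
  have key : ∀ (A : Type) [NormedCommRing A] [NormedAlgebra ℝ A] [NormOneClass A]
      (a : Fin 3 → A), ‖a - fun i => algebraMap ℝ A (q i)‖ < δ →
        ‖a - fun i => algebraMap ℝ A (p i)‖ < ε := by
    intro A _ _ _ a ha
    refine lt_of_lt_of_le ?_ hδ
    rw [← sub_add_sub_cancel a (fun i => algebraMap ℝ A (q i)) fun i => algebraMap ℝ A (p i),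
      add_comm]
    refine (norm_add_le _ _).trans_lt (add_lt_add_of_le_of_lt ?_ ha)
    refine (pi_norm_le_iff_of_nonneg (norm_nonneg _)).2 fun i => ?_
    rw [Pi.sub_apply, ← map_sub, norm_algebraMap']
    exact norm_le_pi_norm ((fun i => q i) - fun i => p i) i
  exact ⟨F, fun A _ _ _ _ a ha => h1 A a (key A a ha),
    fun A B _ _ _ _ _ _ χ a ha => h2 A B χ a (key A a ha), fun y hy => h3 y (key ℝ y hy),
    fun U g hU hg hgε => h4 U g hU hg fun z hz => key ℂ (g z) (hgε z hz)⟩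

theorem pdList_congr {f g : E3 → ℝ} {x : E3} (h : f =ᶠ[nhds x] g) (l : List (Fin 3)) :
    pdList l f =ᶠ[nhds x] pdList l g := by
  induction l with
  | nil => exact h
  | cons i l ih =>
    filter_upwards [ih.eventually_nhds] with y hy
    simp only [pdList, pd, Filter.EventuallyEq.fderiv_eq hy]

theorem pdList_comp_const_add (f : E3 → ℝ) (x : E3) (l : List (Fin 3)) :
    pdList l (fun v => f (x + v)) = fun v => pdList l f (x + v) := by
  induction l with
  | nil => rfl
  | cons i l ih =>
    funext v
    simp only [pdList, pd, ih]
    rw [fderiv_comp_add_left]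

theorem pdList_append (l₁ l₂ : List (Fin 3)) (f : E3 → ℝ) :
    pdList (l₁ ++ l₂) f = pdList l₁ (pdList l₂ f) := by
  induction l₁ with
  | nil => rfl
  | cons i l ih => simp only [List.cons_append, pdList, ih]

theorem AnalyticAt.pdList_eq_iteratedFDeriv {f : E3 → ℝ} {x : E3} (hf : AnalyticAt ℝ f x)
    (l : List (Fin 3)) :
    pdList l f x = iteratedFDeriv ℝ l.length f x fun k => EuclideanSpace.single (l.get k) 1 := by
  induction l generalizing x with
  | nil => simp [pdList]
  | cons i l ih =>
    have h : pdList l f =ᶠ[nhds x] fun y =>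
        iteratedFDeriv ℝ l.length f y fun k => EuclideanSpace.single (l.get k) 1 := by
      filter_upwards [hf.eventually_analyticAt] with y hy using ih hy
    have hd : DifferentiableAt ℝ (iteratedFDeriv ℝ l.length f) x :=
      AnalyticAt.differentiableAt <|
        AnalyticOnNhd.iteratedFDeriv (s := {y | AnalyticAt ℝ f y}) (fun _ hy => hy) l.length x hf
    simp only [pdList, pd]
    rw [h.fderiv_eq]
    simp only [List.length_cons]
    rw [iteratedFDeriv_succ_apply_left]
    rw [fderiv_continuousMultilinear_apply_const_apply hd]
    rfl

/-- Uniform Cauchy estimates for all the functionals of a Banach space valued analytic map. -/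
theorem AnalyticAt.exists_pdList_comp_le {B : Type} [NormedAddCommGroup B] [NormedSpace ℝ B]
    [CompleteSpace B] {Φ : E3 → B} {x : E3} (hΦ : AnalyticAt ℝ Φ x) :
    ∃ C > 0, ∀ (l : List (Fin 3)) (χ : B →L[ℝ] ℝ), ‖χ‖ ≤ 1 →
      |pdList l (fun v => χ (Φ v)) x| ≤ C ^ (l.length + 1) * (Nat.factorial l.length : ℝ) := by
  obtain ⟨P, R, hR⟩ := hΦ
  obtain ⟨C, r, hC, hr, hP⟩ := P.le_mul_pow_of_radius_pos (hR.r_pos.trans_le hR.r_le)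
  refine ⟨max C r, by positivity, fun l χ hχ => ?_⟩
  have h := χ.comp_hasFPowerSeriesOnBall hR
  have h1 : |pdList l (fun v => χ (Φ v)) x| ≤
      ∑ _σ : Equiv.Perm (Fin l.length), C * r ^ l.length := by
    rw [AnalyticAt.pdList_eq_iteratedFDeriv (f := fun v => χ (Φ v)) h.analyticAt l,
      show (fun v => χ (Φ v)) = χ ∘ Φ from rfl,
      h.iteratedFDeriv_eq_sum_of_completeSpace]
    rw [← Real.norm_eq_abs]
    refine norm_sum_le_of_le _ fun σ _ => ?_
    refine (χ.le_of_opNorm_le hχ _).trans ?_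
    rw [one_mul]
    refine ((P _).le_opNorm _).trans ?_
    simpa using hP l.length
  refine h1.trans ?_
  simp only [sum_const, card_univ, Fintype.card_perm, Fintype.card_fin, nsmul_eq_mul]
  rw [mul_comm, pow_succ']
  gcongr
  · exact le_max_left _ _
  · exact le_max_right _ _

theorem Real.analyticAt_tanh (x : ℝ) : AnalyticAt ℝ Real.tanh x := by
  have : Real.tanh = fun y => Real.sinh y / Real.cosh y := funext Real.tanh_eq_sinh_div_cosh
  rw [this]
  exact Real.analyticAt_sinh.div Real.analyticAt_cosh (Real.cosh_pos x).ne'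

theorem Real.one_add_tanh_mul_tanh (x y : ℝ) : 1 + Real.tanh y * Real.tanh x =
    Real.cosh (x + y) / (Real.cosh x * Real.cosh y) := by
  have hx := (Real.cosh_pos x).ne'
  have hy := (Real.cosh_pos y).ne'
  rw [Real.tanh_eq_sinh_div_cosh, Real.tanh_eq_sinh_div_cosh, Real.cosh_add]
  field_simp

theorem Real.tanh_add_eq (x y : ℝ) :
    Real.tanh (x + y) = (Real.tanh x + Real.tanh y) * (1 + Real.tanh y * Real.tanh x)⁻¹ := by
  have h := (Real.cosh_pos (x + y)).ne'
  have hx := (Real.cosh_pos x).ne'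
  have hy := (Real.cosh_pos y).ne'
  rw [Real.one_add_tanh_mul_tanh]
  simp only [Real.tanh_eq_sinh_div_cosh, Real.sinh_add]
  field_simp

/-- The coordinatewise hyperbolic tangent, a diffeomorphism from the space onto an open cube. -/
def tanhMap (x : E3) : E3 := WithLp.toLp 2 fun i => Real.tanh (x i)

@[simp]
theorem tanhMap_apply (x : E3) (i : Fin 3) : tanhMap x i = Real.tanh (x i) := rfl

theorem analyticAt_coord (i : Fin 3) (x : E3) : AnalyticAt ℝ (fun v : E3 => v i) x :=
  (EuclideanSpace.proj (𝕜 := ℝ) i : E3 →L[ℝ] ℝ).analyticAt x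

theorem analyticAt_toLp {g : E3 → Fin 3 → ℝ} {x : E3} (h : ∀ i, AnalyticAt ℝ (fun y => g y i) x) :
    AnalyticAt ℝ (fun y => (WithLp.toLp 2 (g y) : E3)) x :=
  ((PiLp.continuousLinearEquiv 2 ℝ fun _ : Fin 3 => ℝ).symm.toContinuousLinearMap.analyticAt
    _).comp (analyticAt_pi_iff.2 h)

theorem analyticAt_tanhMap (x : E3) : AnalyticAt ℝ tanhMap x :=
  analyticAt_toLp fun i => (Real.analyticAt_tanh (x i)).comp_of_eq (analyticAt_coord i x) rfl

theorem AnalyticAt.exists_pdList_comp_tanhMap_le_of_norm_lt {f : E3 → ℝ} {p : E3}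
    (hf : AnalyticAt ℝ f p) : ∃ ε > 0, ∀ (A : Type) [NormedCommRing A] [NormedAlgebra ℝ A]
      [CompleteSpace A] [NormOneClass A] (T : Fin 3 → A), ‖T - fun i => algebraMap ℝ A (p i)‖ < ε →
      ∃ C > 0, ∀ (χ : A →A[ℝ] ℝ), ‖χ.toContinuousLinearMap‖ ≤ 1 → ∀ x : E3,
        (∀ i, χ (T i) = Real.tanh (x i)) → ∀ l : List (Fin 3),
        |pdList l (fun y => f (tanhMap y)) x| ≤
          C ^ (l.length + 1) * (Nat.factorial l.length : ℝ) := by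
  obtain ⟨ε, hε, F, hFan, hFmap, hFreal, -⟩ := hf.exists_hasFunctionalCalculus
  refine ⟨ε, hε, fun A _ _ _ _ T hT => ?_⟩
  let a : E3 → Fin 3 → A := fun v i =>
    (T i + Real.tanh (v i) • 1) * Ring.inverse (1 + Real.tanh (v i) • T i)
  have htan : ∀ i, AnalyticAt ℝ (fun v : E3 => Real.tanh (v i)) 0 := fun i =>
    (Real.analyticAt_tanh _).comp_of_eq (analyticAt_coord i 0) rfl
  have hden : ∀ i, AnalyticAt ℝ (fun v : E3 => 1 + Real.tanh (v i) • T i) 0 := fun i =>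
    analyticAt_const.add ((htan i).smul analyticAt_const)
  have ha : AnalyticAt ℝ a 0 := by
    refine analyticAt_pi_iff.2 fun i => ?_
    refine (analyticAt_const.add ((htan i).smul analyticAt_const)).mul ?_
    refine AnalyticAt.comp_of_eq (g := Ring.inverse) (analyticAt_inverse (1 : Aˣ)) (hden i) ?_
    simp
  have ha0 : a 0 = T := by
    funext i
    simp [a]
  rw [← ha0] at hT
  obtain ⟨C, hC, h⟩ := ((hFan _ _ hT).comp ha).exists_pdList_comp_le
  refine ⟨C, hC, fun χ hχ x hx l => ?_⟩
  have hev : (fun v => f (tanhMap (x + v))) =ᶠ[nhds 0]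
      fun v => χ.toContinuousLinearMap ((F A ∘ a) v) := by
    have h1 : ∀ᶠ v in nhds (0 : E3), ‖a v - fun i => algebraMap ℝ A (p i)‖ < ε :=
      ((ha.continuousAt.sub continuousAt_const).norm).eventually_lt continuousAt_const hT
    have h2 : ∀ᶠ v in nhds (0 : E3), ∀ i, IsUnit (1 + Real.tanh (v i) • T i) := by
      exact Filter.eventually_all.2 fun i => (hden i).continuousAt.eventually_mem
        (Units.isOpen.mem_nhds (by simp))
    filter_upwards [h1, h2] with v hv1 hv2
    have hval : (fun i => χ (a v i)) = fun i => tanhMap (x + v) i := by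
      funext i
      have hu : χ (Ring.inverse (1 + Real.tanh (v i) • T i)) =
          (1 + Real.tanh (v i) * Real.tanh (x i))⁻¹ := by
        have := congrArg χ (Ring.mul_inverse_cancel _ (hv2 i))
        rw [map_mul, map_one] at this
        rw [eq_inv_of_mul_eq_one_right this]
        simp [hx]
      simp only [a]
      rw [map_mul, hu, tanhMap_apply, PiLp.add_apply, Real.tanh_add_eq]
      simp [hx]
    have hn : ‖(fun i => tanhMap (x + v) i) - fun i => p i‖ < ε := by
      refine lt_of_le_of_lt ((pi_norm_le_iff_of_nonneg (norm_nonneg _)).2 fun i => ?_) hv1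
      refine le_trans ?_ (norm_le_pi_norm _ i)
      have hle := χ.toContinuousLinearMap.le_of_opNorm_le hχ (a v i - algebraMap ℝ A (p i))
      have hp : χ (algebraMap ℝ A (p i)) = p i := AlgHomClass.commutes χ (p i)
      rw [← hval]
      simpa [hp] using hle
    change _ = χ (F _ (a v))
    rw [hFmap _ _ χ _ hv1, hval, hFreal _ hn]
  have hx0 := congrFun (pdList_comp_const_add (fun y => f (tanhMap y)) x l) 0
  rw [add_zero] at hx0
  rw [← hx0, (pdList_congr hev l).eq_of_nhds]
  exact h l _ hχ

open BoundedContinuousFunction in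
theorem AnalyticAt.exists_pdList_comp_tanhMap_le {f : E3 → ℝ} {p : E3} (hf : AnalyticAt ℝ f p) :
    ∃ V ∈ nhds p, ∃ C > 0, ∀ l : List (Fin 3), ∀ x, tanhMap x ∈ V →
      |pdList l (fun y => f (tanhMap y)) x| ≤
        C ^ (l.length + 1) * (Nat.factorial l.length : ℝ) := by
  obtain ⟨ε, hε, h⟩ := hf.exists_pdList_comp_tanhMap_le_of_norm_lt
  refine ⟨Metric.ball p (ε / 2), Metric.ball_mem_nhds p (half_pos hε), ?_⟩
  set S : Set E3 := {x | tanhMap x ∈ Metric.ball p (ε / 2)}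
  rcases S.eq_empty_or_nonempty with hS | hS
  · exact ⟨1, one_pos, fun l x hx => absurd (hS ▸ hx : x ∈ (∅ : Set E3)) (Set.notMem_empty x)⟩
  have : Nonempty S := hS.to_subtype
  have hcont : ∀ i, Continuous fun x : S => Real.tanh (x.1 i) := fun i =>
    (continuous_iff_continuousAt.2 fun x => (Real.analyticAt_tanh x).continuousAt).comp
      ((EuclideanSpace.proj (𝕜 := ℝ) i : E3 →L[ℝ] ℝ).continuous.comp continuous_subtype_val)
  obtain ⟨C, hC, hb⟩ := h (S →ᵇ ℝ) (fun i => ofNormedAddCommGroup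
    (fun x : S => Real.tanh (x.1 i)) (hcont i) 1 fun x => (Real.abs_tanh_lt_one _).le) <| by
    refine lt_of_le_of_lt ?_ (half_lt_self hε)
    refine (pi_norm_le_iff_of_nonneg (half_pos hε).le).2 fun i => ?_
    refine (BoundedContinuousFunction.norm_le (half_pos hε).le).2 fun x => ?_
    have hx : ‖Real.tanh (x.1 i) - p i‖ ≤ ε / 2 := by
      have h1 : dist (tanhMap x.1) p < ε / 2 := x.2
      have h2 := PiLp.norm_apply_le (tanhMap x.1 - p) i
      rw [← dist_eq_norm (tanhMap x.1) p, PiLp.sub_apply, tanhMap_apply] at h2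
      exact h2.trans h1.le
    rw [Pi.sub_apply, BoundedContinuousFunction.sub_apply,
      BoundedContinuousFunction.algebraMap_apply, smul_eq_mul, mul_one]
    exact hx
  refine ⟨C, hC, fun l x hx => ?_⟩
  let χ : (S →ᵇ ℝ) →A[ℝ] ℝ :=
    { toFun := fun g => g ⟨x, hx⟩
      map_one' := rfl
      map_mul' := fun _ _ => rfl
      map_zero' := rfl
      map_add' := fun _ _ => rfl
      commutes' := fun _ => by simp [BoundedContinuousFunction.algebraMap_apply]
      cont := (BoundedContinuousFunction.evalCLM ℝ _).continuous }
  refine hb χ (ContinuousLinearMap.opNorm_le_bound _ zero_le_one fun g => ?_) x (fun i => rfl) l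
  rw [one_mul]
  exact g.norm_coe_le_norm _

/-- A function analytic near a compact set, precomposed with `tanhMap`, satisfies uniform
analyticity bounds over the preimage of the compact set. -/
theorem IsCompact.exists_pdList_comp_tanhMap_le {f : E3 → ℝ} {K : Set E3} (hK : IsCompact K)
    (hf : AnalyticOnNhd ℝ f K) :
    ∃ C > 0, ∀ l : List (Fin 3), ∀ x, tanhMap x ∈ K →
      |pdList l (fun y => f (tanhMap y)) x| ≤
        C ^ (l.length + 1) * (Nat.factorial l.length : ℝ) := by
  refine hK.induction_on (p := fun s => ∃ C > 0, ∀ l : List (Fin 3), ∀ x, tanhMap x ∈ s →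
      |pdList l (fun y => f (tanhMap y)) x| ≤
        C ^ (l.length + 1) * (Nat.factorial l.length : ℝ)) ⟨1, one_pos, by simp⟩ ?_ ?_ ?_
  · rintro s t hst ⟨C, hC, h⟩
    exact ⟨C, hC, fun l x hx => h l x (hst hx)⟩
  · rintro s t ⟨C, hC, h⟩ ⟨C', hC', h'⟩
    refine ⟨max C C', by positivity, ?_⟩
    rintro l x (hx | hx)
    · exact (h l x hx).trans (by gcongr; exact le_max_left _ _)
    · exact (h' l x hx).trans (by gcongr; exact le_max_right _ _)
  · intro p hp
    obtain ⟨V, hV, h⟩ := (hf p hp).exists_pdList_comp_tanhMap_le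
    exact ⟨V, mem_nhdsWithin_of_mem_nhds hV, h⟩

/-- The Cauchy integral formula, with the circle cut into two half circles. -/
theorem Complex.integral_halfCircle_add_integral_halfCircle {g : ℂ → ℂ} {r R : ℝ} (hr : 0 < r)
    (hrR : r < R) (hg : DifferentiableOn ℂ g (Metric.ball 0 R)) {w : ℂ} (hw : ‖w‖ < r) :
    (∫ θ in -(Real.pi / 2)..Real.pi / 2,
        g (circleMap 0 r θ) * circleMap 0 r θ * (circleMap 0 r θ - w)⁻¹) +
      (∫ θ in -(Real.pi / 2)..Real.pi / 2,
        g (-circleMap 0 r θ) * -circleMap 0 r θ * (-circleMap 0 r θ - w)⁻¹) =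
      2 * Real.pi * g w := by
  set k : ℝ → ℂ := fun θ => g (circleMap 0 r θ) * circleMap 0 r θ * (circleMap 0 r θ - w)⁻¹
  have hζ : ∀ θ, ‖circleMap 0 r θ‖ = r := fun θ => by simp [abs_of_pos hr]
  have hneg : ∀ θ, circleMap 0 r (θ + Real.pi) = -circleMap 0 r θ := fun θ => by
    simp [circleMap, add_mul, Complex.exp_add]
  have hc : Continuous k := by
    have h0 := continuous_circleMap 0 r
    refine ((hg.continuousOn.comp_continuous h0 fun θ => ?_).mul h0).mul
      ((h0.sub continuous_const).inv₀ fun θ h => ?_)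
    · rw [mem_ball_zero_iff, hζ]; exact hrR
    · have h1 : circleMap 0 r θ = w := sub_eq_zero.1 h
      exact hw.ne (by rw [← h1, hζ])
  have hper : Function.Periodic k (2 * Real.pi) := fun θ => by
    simp only [k, periodic_circleMap 0 r θ]
  have h2 : (∫ θ in -(Real.pi / 2)..Real.pi / 2,
      g (-circleMap 0 r θ) * -circleMap 0 r θ * (-circleMap 0 r θ - w)⁻¹) =
      ∫ θ in Real.pi / 2..-(Real.pi / 2) + 2 * Real.pi, k θ := by
    have := intervalIntegral.integral_comp_add_right (a := -(Real.pi / 2)) (b := Real.pi / 2) k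
      Real.pi
    simp only [k, hneg] at this
    rw [this]
    congr 1 <;> ring
  rw [h2, intervalIntegral.integral_add_adjacent_intervals (hc.intervalIntegrable _ _)
    (hc.intervalIntegrable _ _), hper.intervalIntegral_add_eq _ 0, zero_add]
  have hcau := DifferentiableOn.circleIntegral_sub_inv_smul (c := 0) (R := r) (w := w)
    (hg.mono (Metric.closedBall_subset_ball hrR)) (by simpa using hw)
  simp only [circleIntegral, deriv_circleMap, smul_eq_mul] at hcau
  have hI : ∫ θ in (0 : ℝ)..2 * Real.pi, k θ = (Complex.I)⁻¹ * (2 * Real.pi * Complex.I * g w) := by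
    rw [← hcau, ← intervalIntegral.integral_const_mul]
    refine intervalIntegral.integral_congr fun θ _ => ?_
    simp only [k]
    field_simp
  rw [hI]
  field_simp

/-- The point `x` with its `j`-th coordinate replaced by `t`. -/
def setCoord (j : Fin 3) (t : ℝ) (x : E3) : E3 := WithLp.toLp 2 (Function.update x.ofLp j t)

@[simp]
theorem setCoord_same (j : Fin 3) (t : ℝ) (x : E3) : setCoord j t x j = t := by simp [setCoord]

theorem setCoord_of_ne {i j : Fin 3} (h : i ≠ j) (t : ℝ) (x : E3) : setCoord j t x i = x i := by
  simp [setCoord, h]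

@[simp]
theorem setCoord_eq_self (j : Fin 3) (x : E3) : setCoord j (x j) x = x := by simp [setCoord]

/-- The holomorphic extension of `t ↦ h (setCoord j (c + t) x)` to a disc of radius `ρ`
(zero if there is no such extension). -/
def complexSlice (h : E3 → ℝ) (j : Fin 3) (c ρ : ℝ) (x : E3) : ℂ → ℂ :=
  open Classical in
  if H : ∃ g : ℂ → ℂ, DifferentiableOn ℂ g (Metric.ball 0 ρ) ∧
    ∀ t : ℝ, |t| < ρ → g t = h (setCoord j (c + t) x) then H.choose else 0

theorem complexSlice_spec {h : E3 → ℝ} {j : Fin 3} {c ρ : ℝ} {x : E3} {g : ℂ → ℂ} (hρ : 0 < ρ)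
    (hg : DifferentiableOn ℂ g (Metric.ball 0 ρ))
    (hgh : ∀ t : ℝ, |t| < ρ → g t = h (setCoord j (c + t) x)) :
    DifferentiableOn ℂ (complexSlice h j c ρ x) (Metric.ball 0 ρ) ∧
      (∀ t : ℝ, |t| < ρ → complexSlice h j c ρ x t = h (setCoord j (c + t) x)) ∧
      Set.EqOn (complexSlice h j c ρ x) g (Metric.ball 0 ρ) := by
  have H : ∃ g : ℂ → ℂ, DifferentiableOn ℂ g (Metric.ball 0 ρ) ∧
    ∀ t : ℝ, |t| < ρ → g t = h (setCoord j (c + t) x) := ⟨g, hg, hgh⟩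
  have e : complexSlice h j c ρ x = H.choose := dif_pos H
  rw [e]
  refine ⟨H.choose_spec.1, H.choose_spec.2, ?_⟩
  refine AnalyticOnNhd.eqOn_of_preconnected_of_frequently_eq
    (H.choose_spec.1.analyticOnNhd Metric.isOpen_ball) (hg.analyticOnNhd Metric.isOpen_ball)
    (convex_ball _ _).isPreconnected (Metric.mem_ball_self hρ) ?_
  have ht : Filter.Tendsto (fun t : ℝ => (t : ℂ)) (nhdsWithin 0 {0}ᶜ) (nhdsWithin 0 {0}ᶜ) := by
    refine tendsto_nhdsWithin_iff.2 ⟨?_, ?_⟩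
    · exact (Complex.continuous_ofReal.tendsto' 0 0 Complex.ofReal_zero).mono_left
        nhdsWithin_le_nhds
    · filter_upwards [self_mem_nhdsWithin] with t ht
      simpa using ht
  refine ht.frequently (Filter.Eventually.frequently ?_)
  filter_upwards [nhdsWithin_le_nhds (Metric.ball_mem_nhds (0 : ℝ) hρ)] with t ht
  have ht' : |t| < ρ := by simpa using ht
  rw [H.choose_spec.2 t ht', hgh t ht']

theorem norm_update_sub_lt {A : Type} [NormedCommRing A] {j : Fin 3} {a b : Fin 3 → A} {t : A}
    {ρ : ℝ} (hρ : 0 < ρ) (ht : ‖t - b j‖ < ρ) (ha : ∀ i ≠ j, ‖a i - b i‖ < ρ) :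
    ‖Function.update a j t - b‖ < ρ := by
  refine (pi_norm_lt_iff hρ).2 fun i => ?_
  rcases eq_or_ne i j with rfl | hi
  · simpa using ht
  · simpa [hi] using ha i hi

theorem HasFunctionalCalculus.exists_complexSlice {h : E3 → ℝ} {q : E3} {ρ : ℝ}
    (hF : HasFunctionalCalculus h q ρ) (hρ : 0 < ρ) (j : Fin 3) :
    ∃ F : ∀ (A : Type) [NormedCommRing A] [NormedAlgebra ℝ A], (Fin 3 → A) → A,
      (∀ (A : Type) [NormedCommRing A] [NormedAlgebra ℝ A] [CompleteSpace A] [NormOneClass A]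
        (a : Fin 3 → A), ‖a - fun i => algebraMap ℝ A (q i)‖ < ρ → AnalyticAt ℝ (F A) a) ∧
      (∀ (A B : Type) [NormedCommRing A] [NormedAlgebra ℝ A] [CompleteSpace A] [NormOneClass A]
        [NormedCommRing B] [NormedAlgebra ℝ B] (χ : A →A[ℝ] B) (a : Fin 3 → A),
        ‖a - fun i => algebraMap ℝ A (q i)‖ < ρ → χ (F A a) = F B fun i => χ (a i)) ∧
      ∀ y : E3, (∀ i ≠ j, |y i - q i| < ρ) →
        DifferentiableOn ℂ (complexSlice h j (q j) ρ y) (Metric.ball 0 ρ) ∧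
        (∀ t : ℝ, |t| < ρ → complexSlice h j (q j) ρ y t = h (setCoord j (q j + t) y)) ∧
        ∀ z ∈ Metric.ball (0 : ℂ) ρ, complexSlice h j (q j) ρ y z =
          F ℂ (Function.update (fun i => (y i : ℂ)) j (q j + z)) := by
  obtain ⟨F, h1, h2, h3, h4⟩ := hF
  refine ⟨F, h1, h2, fun y hy => ?_⟩
  refine complexSlice_spec hρ ?_ ?_
  · refine h4 _ _ Metric.isOpen_ball (fun i => ?_) fun z hz => ?_
    · rcases eq_or_ne i j with rfl | hi
      · simpa using differentiableOn_id.const_add (q i : ℂ)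
      · simp [hi]
    · refine norm_update_sub_lt hρ (by simpa using hz) fun i hi => ?_
      rw [← Complex.ofReal_sub, Complex.norm_real]
      exact hy i hi
  · intro t ht
    obtain ⟨χ, hχ⟩ : ∃ χ : ℝ →A[ℝ] ℂ, ∀ t, χ t = t :=
      ⟨⟨Complex.ofRealAm, Complex.continuous_ofReal⟩, fun _ => rfl⟩
    have hn : ‖Function.update y.ofLp j (q j + t) - fun i => q i‖ < ρ :=
      norm_update_sub_lt hρ (by simpa using ht) hy
    have := h2 ℝ ℂ χ _ hn
    rw [h3 _ hn, hχ] at this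
    refine Eq.trans (congrArg (F ℂ) ?_) this.symm
    funext i
    rcases eq_or_ne i j with rfl | hi
    · simp [hχ]
    · simp [hχ, hi]

/-- The Cauchy integral of `h` in the `j`-th variable over a half circle with centre `c` and radius
`ρ / 2`; the half circle lies to the right of the centre if `s = 1` and to the left if `s = -1`. -/
def halfCauchy (h : E3 → ℝ) (j : Fin 3) (c ρ s : ℝ) (x : E3) : ℝ :=
  ((2 * Real.pi : ℂ)⁻¹ * ∫ θ in -(Real.pi / 2)..Real.pi / 2,
    complexSlice h j c ρ x (s * circleMap 0 (ρ / 2) θ) * (s * circleMap 0 (ρ / 2) θ) *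
      (s * circleMap 0 (ρ / 2) θ - ((x j - c : ℝ) : ℂ))⁻¹).re

theorem analyticAt_halfCauchy {h : E3 → ℝ} {j : Fin 3} {c ρ s : ℝ} {x : E3} (hρ : 0 < ρ)
    (hs : |s| ≤ 1) (hF : HasFunctionalCalculus h (setCoord j c x) ρ)
    (hx : ∀ θ ∈ Set.Icc (-(Real.pi / 2)) (Real.pi / 2),
      (s * circleMap 0 (ρ / 2) θ - ((x j - c : ℝ) : ℂ)) ≠ 0) :
    AnalyticAt ℝ (halfCauchy h j c ρ s) x := by
  obtain ⟨F, hFan, hFmap, hslice⟩ := hF.exists_complexSlice hρ j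
  simp only [setCoord_same] at hslice
  have hpi : -(Real.pi / 2) ≤ Real.pi / 2 := by linarith [Real.pi_pos]
  set K := Set.Icc (-(Real.pi / 2)) (Real.pi / 2)
  have : Nonempty K := ⟨⟨0, by constructor <;> linarith [Real.pi_pos]⟩⟩
  let ζ : C(K, ℂ) := ⟨fun θ => s * circleMap 0 (ρ / 2) θ.1,
    continuous_const.mul ((continuous_circleMap 0 _).comp continuous_subtype_val)⟩
  have hζρ : ∀ θ : ℝ, ‖(s : ℂ) * circleMap 0 (ρ / 2) θ‖ ≤ ρ / 2 := fun θ => by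
    rw [norm_mul, norm_circleMap_zero, Complex.norm_real, Real.norm_eq_abs,
      abs_of_pos (half_pos hρ)]
    exact mul_le_of_le_one_left (half_pos hρ).le hs
  have hζ : ‖ζ‖ < ρ :=
    ((ContinuousMap.norm_le _ (half_pos hρ).le).2 fun θ => hζρ _).trans_lt (half_lt_self hρ)
  let a : E3 → Fin 3 → C(K, ℂ) := fun y =>
    Function.update (fun i => algebraMap ℝ C(K, ℂ) (y i)) j (algebraMap ℝ C(K, ℂ) c + ζ)
  have hcoord : ∀ i, AnalyticAt ℝ (fun y : E3 => algebraMap ℝ C(K, ℂ) (y i)) x := fun i =>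
    ((algebraMapCLM ℝ C(K, ℂ)).analyticAt _).comp (analyticAt_coord i x)
  have ha : AnalyticAt ℝ a x := by
    refine analyticAt_pi_iff.2 fun i => ?_
    rcases eq_or_ne i j with rfl | hi
    · simpa [a] using analyticAt_const
    · simpa [a, hi] using hcoord i
  have hnorm : ∀ y : E3, (∀ i ≠ j, |y i - x i| < ρ) →
      ‖a y - fun i => algebraMap ℝ C(K, ℂ) (setCoord j c x i)‖ < ρ := fun y hy => by
    refine norm_update_sub_lt hρ (by simpa using hζ) fun i hi => ?_
    rw [setCoord_of_ne hi, ← map_sub, norm_algebraMap']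
    exact hy i hi
  let D : E3 → C(K, ℂ) := fun y => ζ - algebraMap ℝ C(K, ℂ) (y j - c)
  have hD : AnalyticAt ℝ D x := by
    refine analyticAt_const.sub ?_
    simp only [map_sub]
    exact (hcoord j).sub analyticAt_const
  have hDval : ∀ y (θ : K), D y θ = s * circleMap 0 (ρ / 2) θ.1 - ((y j - c : ℝ) : ℂ) :=
    fun y θ => rfl
  have hDx : IsUnit (D x) := ContinuousMap.isUnit_iff_forall_ne_zero _ |>.2 fun θ => by
    rw [hDval]; exact hx _ θ.2
  let W : E3 → C(K, ℂ) := fun y => F _ (a y) * ζ * Ring.inverse (D y)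
  have hW : AnalyticAt ℝ W x := by
    obtain ⟨u, hu⟩ := hDx
    exact (((hFan _ _ (hnorm x (by simp [hρ]))).comp ha).mul analyticAt_const).mul
      ((analyticAt_inverse u).comp_of_eq hD hu.symm)
  have hcont : ∀ w : C(K, ℂ), Continuous (Set.IccExtend hpi w) := fun w => w.continuous.Icc_extend'
  have hint : ∀ w : C(K, ℂ), IntervalIntegrable (Set.IccExtend hpi w) volume (-(Real.pi / 2))
      (Real.pi / 2) := fun w => (hcont w).intervalIntegrable _ _
  let L₀ : C(K, ℂ) →ₗ[ℝ] ℝ :=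
    { toFun := fun w => ((2 * Real.pi : ℂ)⁻¹ * ∫ θ in -(Real.pi / 2)..Real.pi / 2,
        Set.IccExtend hpi w θ).re
      map_add' := fun w₁ w₂ => by
        rw [← Complex.add_re, ← mul_add,
          ← intervalIntegral.integral_add (hint w₁) (hint w₂)]
        rfl
      map_smul' := fun r w => by
        rw [RingHom.id_apply, smul_eq_mul, ← Complex.re_ofReal_mul, mul_left_comm,
          ← intervalIntegral.integral_const_mul (r : ℂ)]
        refine congrArg (fun t => ((2 * Real.pi : ℂ)⁻¹ * t).re)
          (intervalIntegral.integral_congr fun θ _ => ?_)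
        simp [Set.IccExtend] }
  have hL : ∃ L : C(K, ℂ) →L[ℝ] ℝ, ∀ w, L w = L₀ w := by
    refine ⟨L₀.mkContinuous (‖(2 * Real.pi : ℂ)⁻¹‖ * |Real.pi / 2 - -(Real.pi / 2)|) fun w => ?_,
      fun w => rfl⟩
    refine (Complex.abs_re_le_norm _).trans ?_
    rw [norm_mul, mul_assoc]
    refine mul_le_mul_of_nonneg_left ?_ (norm_nonneg _)
    rw [mul_comm]
    exact intervalIntegral.norm_integral_le_of_norm_le_const fun θ _ => w.norm_coe_le_norm _
  obtain ⟨L, hL⟩ := hL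
  refine ((L.analyticAt _).comp hW).congr ?_
  have h1 : ∀ᶠ y in nhds x, IsUnit (D y) :=
    hD.continuousAt.eventually_mem (Units.isOpen.mem_nhds hDx)
  have h2 : ∀ᶠ y in nhds x, ∀ i ≠ j, |y i - x i| < ρ := by
    refine Filter.eventually_all.2 fun i => ?_
    have := (analyticAt_coord i x).continuousAt.eventually_mem (Metric.ball_mem_nhds _ hρ)
    filter_upwards [this] with y hy _
    simpa [Real.dist_eq] using hy
  filter_upwards [h1, h2] with y hy1 hy2
  change L (W y) = _
  rw [hL]
  refine congrArg (fun t => ((2 * Real.pi : ℂ)⁻¹ * t).re) (intervalIntegral.integral_congr ?_)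
  intro θ hθ
  rw [Set.uIcc_of_le hpi] at hθ
  simp only [Set.IccExtend_of_mem hpi _ hθ]
  obtain ⟨χ, hχ⟩ : ∃ χ : C(K, ℂ) →A[ℝ] ℂ, ∀ w, χ w = w ⟨θ, hθ⟩ :=
    ⟨⟨(ContinuousMap.evalAlgHom ℝ ℂ (⟨θ, hθ⟩ : K)), continuous_eval_const _⟩,
      fun w => rfl⟩
  have hinv : χ (Ring.inverse (D y)) = (D y ⟨θ, hθ⟩)⁻¹ := by
    have := congrArg χ (Ring.mul_inverse_cancel _ hy1)
    rw [map_mul, map_one] at this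
    rw [eq_inv_of_mul_eq_one_right this, hχ]
  have hy2' : ∀ i ≠ j, |y i - setCoord j c x i| < ρ := fun i hi => by
    rw [setCoord_of_ne hi]; exact hy2 i hi
  rw [(hslice y hy2').2.2 _ (by simpa using (hζρ θ).trans_lt (half_lt_self hρ)), ← hDval y ⟨θ, hθ⟩,
    ← hinv, ← hχ, map_mul, map_mul, hFmap _ _ χ _ (hnorm y hy2), hχ ζ]
  congr 3
  funext i
  rw [hχ]
  rcases eq_or_ne i j with rfl | hi
  · simp [a, ζ]
  · simp [a, hi]

theorem IsCompact.exists_forall_hasFunctionalCalculus {h : E3 → ℝ} {K : Set E3} (hK : IsCompact K)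
    (hh : AnalyticOnNhd ℝ h K) : ∃ ρ > 0, ∀ q ∈ K, HasFunctionalCalculus h q ρ := by
  refine hK.induction_on (p := fun s => ∃ ρ > 0, ∀ q ∈ s, HasFunctionalCalculus h q ρ) ?_ ?_ ?_ ?_
  · exact ⟨1, one_pos, by simp⟩
  · rintro s t hst ⟨ρ, hρ, H⟩
    exact ⟨ρ, hρ, fun q hq => H q (hst hq)⟩
  · rintro s t ⟨ρ, hρ, H⟩ ⟨ρ', hρ', H'⟩
    refine ⟨min ρ ρ', lt_min hρ hρ', fun q hq => ?_⟩
    rcases hq with hq | hq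
    · exact (H q hq).mono (by simp)
    · exact (H' q hq).mono (by simp)
  · intro p hp
    obtain ⟨ε, hε, H⟩ := (hh p hp).exists_hasFunctionalCalculus
    refine ⟨Metric.ball p (ε / 2),
      mem_nhdsWithin_of_mem_nhds (Metric.ball_mem_nhds _ (half_pos hε)),
      ε / 2, half_pos hε, fun q hq => H.mono ?_⟩
    have h1 : ‖(fun i => q i) - fun i => p i‖ ≤ dist q p := by
      refine (pi_norm_le_iff_of_nonneg dist_nonneg).2 fun i => ?_
      rw [dist_eq_norm]
      exact PiLp.norm_apply_le (q - p) i
    have h2 := Metric.mem_ball.1 hq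
    linarith

theorem ofReal_mul_circleMap_sub_ne_zero {s t r θ : ℝ} (hr : 0 < r)
    (hs : s = 1 ∨ s = -1) (ht : s * t ≤ 0) (hθ : θ ∈ Set.Icc (-(Real.pi / 2)) (Real.pi / 2)) :
    (s * circleMap 0 r θ - (t : ℂ)) ≠ 0 := by
  intro h
  have hs2 : (s : ℂ) * s = 1 := by rcases hs with rfl | rfl <;> simp
  have h1 : circleMap 0 r θ = ((s * t : ℝ) : ℂ) := by
    rw [Complex.ofReal_mul, ← sub_eq_zero.1 h, ← mul_assoc, hs2, one_mul]
  have h2 : 0 ≤ s * t := by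
    have h3 := congrArg Complex.re h1
    rw [Complex.ofReal_re] at h3
    rw [← h3]
    simpa [circleMap, Complex.exp_re] using mul_nonneg hr.le (Real.cos_nonneg_of_mem_Icc hθ)
  rw [le_antisymm ht h2] at h1
  have h4 := norm_circleMap_zero r θ
  rw [h1] at h4
  simp at h4
  exact (abs_pos.2 hr.ne').ne h4

theorem eventually_abs_coord_sub_lt (x : E3) {ρ : ℝ} (hρ : 0 < ρ) :
    ∀ᶠ y in nhds x, ∀ i, |y i - x i| < ρ := by
  refine Filter.eventually_all.2 fun i => ?_
  have := (analyticAt_coord i x).continuousAt.eventually_mem (Metric.ball_mem_nhds _ hρ)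
  filter_upwards [this] with y hy
  simpa [Real.dist_eq] using hy

/-- Analytic functions near a face split additively into a function analytic on the left and one
analytic on the right of the face. -/
theorem exists_analytic_splitting {h : E3 → ℝ} {S : Set E3} {j : Fin 3} {c : ℝ} (hS : IsCompact S)
    (hSc : ∀ x ∈ S, setCoord j c x ∈ S) (hh : ∀ x ∈ S, x j = c → AnalyticAt ℝ h x) :
    ∃ hA hB : E3 → ℝ, (∀ x ∈ S, x j ≤ c → AnalyticAt ℝ hA x) ∧
      (∀ x ∈ S, c ≤ x j → AnalyticAt ℝ hB x) ∧
      ∀ x ∈ S, x j = c → ∀ᶠ y in nhds x, hA y + hB y = h y := by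
  have hK : IsCompact (S ∩ {x | x j = c}) := hS.inter_right
    (isClosed_eq (continuous_iff_continuousAt.2 fun x => (analyticAt_coord j x).continuousAt)
      continuous_const)
  obtain ⟨ρ, hρ, H⟩ := hK.exists_forall_hasFunctionalCalculus (h := h) fun x hx => hh x hx.1 hx.2
  have key : ∀ s : ℝ, (s = 1 ∨ s = -1) → ∀ x ∈ S, s * (x j - c) ≤ 0 →
      AnalyticAt ℝ (halfCauchy h j c ρ s) x := fun s hs x hx hxs =>
    analyticAt_halfCauchy hρ (by rcases hs with rfl | rfl <;> simp)
      (H _ ⟨hSc x hx, by simp⟩)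
      fun θ hθ => ofReal_mul_circleMap_sub_ne_zero (half_pos hρ) hs hxs hθ
  refine ⟨halfCauchy h j c ρ 1, halfCauchy h j c ρ (-1),
    fun x hx hxc => key 1 (by simp) x hx (by linarith),
    fun x hx hxc => key (-1) (by simp) x hx (by linarith), fun x hx hxc => ?_⟩
  obtain ⟨F, -, -, hF⟩ := (H x ⟨hx, hxc⟩).exists_complexSlice hρ j
  filter_upwards [eventually_abs_coord_sub_lt x (half_pos hρ)] with y hy
  obtain ⟨hd, hv, -⟩ := hF y fun i _ => (hy i).trans (half_lt_self hρ)
  rw [hxc] at hd hv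
  have hyj : |y j - c| < ρ / 2 := hxc ▸ hy j
  have hw : ‖((y j - c : ℝ) : ℂ)‖ < ρ / 2 := by rwa [Complex.norm_real]
  have h1 := Complex.integral_halfCircle_add_integral_halfCircle (half_pos hρ) (half_lt_self hρ)
    hd hw
  rw [hv _ (hyj.trans (half_lt_self hρ)), add_sub_cancel, setCoord_eq_self] at h1
  have h2 : (2 * Real.pi : ℂ) ≠ 0 := by simp [Real.pi_ne_zero]
  have h3 : ((2 * Real.pi : ℂ)⁻¹ * (2 * Real.pi * h y)).re = h y := by
    rw [inv_mul_cancel_left₀ h2, Complex.ofReal_re]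
  rw [← h3, ← h1, halfCauchy, halfCauchy, ← Complex.add_re, ← mul_add]
  simp

/-- The additive Cousin problem with local data `σ q` near `q` is solvable on `S`. -/
def CousinSolvable (σ : E3 → E3 → ℝ) (S : Set E3) : Prop :=
  ∃ m : E3 → ℝ, ∀ q ∈ S, AnalyticAt ℝ (fun y => m y - σ q y) q

theorem CousinSolvable.mono {σ : E3 → E3 → ℝ} {S T : Set E3} (h : CousinSolvable σ T)
    (hST : S ⊆ T) : CousinSolvable σ S :=
  let ⟨m, hm⟩ := h
  ⟨m, fun q hq => hm q (hST hq)⟩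

theorem CousinSolvable.merge {σ : E3 → E3 → ℝ} {S : Set E3} {j : Fin 3} {c : ℝ} (hS : IsCompact S)
    (hSc : ∀ x ∈ S, setCoord j c x ∈ S) (hA : CousinSolvable σ (S ∩ {x | x j ≤ c}))
    (hB : CousinSolvable σ (S ∩ {x | c ≤ x j})) : CousinSolvable σ S := by
  obtain ⟨mA, hA⟩ := hA
  obtain ⟨mB, hB⟩ := hB
  obtain ⟨gA, gB, hgA, hgB, hg⟩ := exists_analytic_splitting (h := fun y => mA y - mB y) hS hSc
    fun x hx hxc => ((hA x ⟨hx, hxc.le⟩).sub (hB x ⟨hx, hxc.ge⟩)).congr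
      (Filter.Eventually.of_forall fun y => by simp)
  have hcoord : ∀ q : E3, Filter.Tendsto (fun y : E3 => y j) (nhds q) (nhds (q j)) := fun q =>
    (analyticAt_coord j q).continuousAt
  refine ⟨fun y => if y j ≤ c then mA y - gA y else mB y + gB y, fun q hq => ?_⟩
  rcases lt_trichotomy (q j) c with hqc | hqc | hqc
  · refine ((hA q ⟨hq, hqc.le⟩).sub (hgA q hq hqc.le)).congr ?_
    filter_upwards [(hcoord q).eventually_lt_const hqc] with y hy
    simp only [Pi.sub_apply, if_pos hy.le]
    ring
  · refine ((hA q ⟨hq, hqc.le⟩).sub (hgA q hq hqc.le)).congr ?_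
    filter_upwards [hg q hq hqc] with y hy
    simp only [Pi.sub_apply]
    split_ifs <;> linarith
  · refine ((hB q ⟨hq, hqc.le⟩).add (hgB q hq hqc.le)).congr ?_
    filter_upwards [(hcoord q).eventually_const_lt hqc] with y hy
    simp only [Pi.add_apply, if_neg hy.not_ge]
    ring

/-- A closed box in `E3`. -/
def closedBox (a b : Fin 3 → ℝ) : Set E3 := {x | ∀ i, a i ≤ x i ∧ x i ≤ b i}

theorem isCompact_closedBox (a b : Fin 3 → ℝ) : IsCompact (closedBox a b) := by
  convert (isCompact_Icc (a := a) (b := b)).image (PiLp.continuous_toLp 2 fun _ : Fin 3 => ℝ)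
  ext x
  refine ⟨fun hx => ⟨x.ofLp, ⟨fun i => (hx i).1, fun i => (hx i).2⟩, rfl⟩, ?_⟩
  rintro ⟨y, ⟨h1, h2⟩, rfl⟩
  exact fun i => ⟨h1 i, h2 i⟩

theorem exists_cousinSolvable_of_small {σ : E3 → E3 → ℝ} {a₀ b₀ : Fin 3 → ℝ}
    (hσ : ∀ q ∈ closedBox a₀ b₀, ∀ᶠ q' in nhds q, AnalyticAt ℝ (fun y => σ q y - σ q' y) q') :
    ∃ δ > 0, ∀ a b, closedBox a b ⊆ closedBox a₀ b₀ → (∀ i, b i - a i ≤ δ) →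
      CousinSolvable σ (closedBox a b) := by
  have hσ' : ∀ q : closedBox a₀ b₀, ∃ V : Set E3, IsOpen V ∧ q.1 ∈ V ∧
      ∀ q' ∈ V, AnalyticAt ℝ (fun y => σ q y - σ q' y) q' := fun q => by
    obtain ⟨V, h1, h2, h3⟩ := eventually_nhds_iff.1 (hσ q q.2)
    exact ⟨V, h2, h3, h1⟩
  choose V hVo hqV hV using hσ'
  have ht := PiLp.continuous_toLp 2 fun _ : Fin 3 => ℝ
  obtain ⟨δ, hδ, H⟩ := lebesgue_number_lemma_of_metric (isCompact_Icc (a := a₀) (b := b₀))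
    (fun q => (hVo q).preimage ht) fun y hy => Set.mem_iUnion.2
      ⟨⟨WithLp.toLp 2 y, fun i => ⟨hy.1 i, hy.2 i⟩⟩, hqV _⟩
  refine ⟨δ / 2, half_pos hδ, fun a b hab hδ' => ?_⟩
  rcases (closedBox a b).eq_empty_or_nonempty with he | ⟨x, hx⟩
  · exact ⟨0, by simp [he]⟩
  obtain ⟨q, hq⟩ := H x.ofLp ⟨fun i => (hab hx i).1, fun i => (hab hx i).2⟩
  refine ⟨σ q, fun q' hq' => hV q q' ?_⟩
  have hb : q'.ofLp ∈ Metric.ball x.ofLp δ → q' ∈ V q := fun h => hq h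
  refine hb ((dist_pi_lt_iff hδ).2 fun i => ?_)
  rw [Real.dist_eq, abs_sub_lt_iff]
  have h1 := hδ' i
  have h2 := hx i
  have h3 := hq' i
  constructor <;> linarith

theorem cousinSolvable_of_side_le {σ : E3 → E3 → ℝ} {B : Set E3} {δ : ℝ} {s : Finset (Fin 3)}
    {j : Fin 3} (hδ : 0 < δ)
    (H : ∀ a b, closedBox a b ⊆ B → (∀ i ∉ s, b i - a i ≤ δ) → CousinSolvable σ (closedBox a b))
    (n : ℕ) : ∀ a b, closedBox a b ⊆ B → (∀ i ∉ insert j s, b i - a i ≤ δ) →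
      b j - a j ≤ (n + 1) * δ → CousinSolvable σ (closedBox a b) := by
  have H' : ∀ a b, closedBox a b ⊆ B → (∀ i ∉ insert j s, b i - a i ≤ δ) → b j - a j ≤ δ →
      CousinSolvable σ (closedBox a b) := fun a b hab h1 h2 => by
    refine H a b hab fun i hi => ?_
    rcases eq_or_ne i j with rfl | hij
    · exact h2
    · exact h1 i (by simp [hij, hi])
  induction n with
  | zero => exact fun a b hab h1 h2 => H' a b hab h1 (by simpa using h2)
  | succ n ih =>
    intro a b hab h1 h2
    rcases le_or_gt (b j - a j) δ with h3 | h3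
    · exact H' a b hab h1 h3
    have hj : ∀ i ∉ insert j s, i ≠ j := fun i hi h => hi (by simp [h])
    have hA : closedBox a b ∩ {x | x j ≤ a j + δ} =
        closedBox a (Function.update b j (a j + δ)) := by
      ext x
      refine ⟨fun hx i => ?_, fun hx => ⟨fun i => ?_, ?_⟩⟩
      · rcases eq_or_ne i j with rfl | hij
        · simpa using ⟨(hx.1 i).1, hx.2⟩
        · simpa [hij] using hx.1 i
      · rcases eq_or_ne i j with rfl | hij
        · have := hx i
          simp only [Function.update_self] at this
          exact ⟨this.1, by linarith⟩
        · simpa [hij] using hx i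
      · simpa using (hx j).2
    have hB : closedBox a b ∩ {x | a j + δ ≤ x j} =
        closedBox (Function.update a j (a j + δ)) b := by
      ext x
      refine ⟨fun hx i => ?_, fun hx => ⟨fun i => ?_, ?_⟩⟩
      · rcases eq_or_ne i j with rfl | hij
        · simpa using ⟨hx.2, (hx.1 i).2⟩
        · simpa [hij] using hx.1 i
      · rcases eq_or_ne i j with rfl | hij
        · have := hx i
          simp only [Function.update_self] at this
          exact ⟨by linarith, this.2⟩
        · simpa [hij] using hx i
      · simpa using (hx j).1
    refine CousinSolvable.merge (j := j) (c := a j + δ) (isCompact_closedBox a b)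
      (fun x hx i => ?_) ?_ ?_
    · rcases eq_or_ne i j with rfl | hij
      · simp only [setCoord_same]
        exact ⟨by linarith, by linarith⟩
      · simpa [setCoord_of_ne hij] using hx i
    · rw [hA]
      refine H' _ _ (hA ▸ Set.inter_subset_left.trans hab) (fun i hi => ?_) (by simp)
      simpa [hj i hi] using h1 i hi
    · rw [hB]
      refine ih _ _ (hB ▸ Set.inter_subset_left.trans hab) (fun i hi => ?_) ?_
      · simpa [hj i hi] using h1 i hi
      · push_cast at h2
        simp only [Function.update_self]
        linarith

/-- The additive Cousin problem for real-analytic functions is solvable on closed boxes. -/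
theorem cousinSolvable_closedBox {σ : E3 → E3 → ℝ} {a b : Fin 3 → ℝ}
    (hσ : ∀ q ∈ closedBox a b, ∀ᶠ q' in nhds q, AnalyticAt ℝ (fun y => σ q y - σ q' y) q') :
    CousinSolvable σ (closedBox a b) := by
  obtain ⟨δ, hδ, H⟩ := exists_cousinSolvable_of_small hσ
  have key : ∀ s : Finset (Fin 3), ∀ a' b', closedBox a' b' ⊆ closedBox a b →
      (∀ i ∉ s, b' i - a' i ≤ δ) → CousinSolvable σ (closedBox a' b') := by
    intro s
    induction s using Finset.induction_on with
    | empty => exact fun a' b' h h' => H a' b' h fun i => h' i (by simp)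
    | insert j s _ ih =>
      intro a' b' h h'
      obtain ⟨n, hn⟩ := exists_nat_ge ((b' j - a' j) / δ)
      refine cousinSolvable_of_side_le hδ ih n a' b' h h' ?_
      rw [div_le_iff₀ hδ] at hn
      linarith
  exact key univ a b subset_rfl fun i hi => absurd (mem_univ i) hi

/-- The inverse of `tanhMap` on the open cube. -/
def artanhMap (u : E3) : E3 := WithLp.toLp 2 fun i => Real.artanh (u i)

theorem artanhMap_tanhMap (x : E3) : artanhMap (tanhMap x) = x := by
  ext i
  exact Real.artanh_tanh (x i)

theorem Real.analyticAt_artanh {t : ℝ} (ht : |t| < 1) : AnalyticAt ℝ Real.artanh t := by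
  have h1 := abs_lt.1 ht
  have h2 : AnalyticAt ℝ (fun y : ℝ => 1 / 2 * Real.log ((1 + y) / (1 - y))) t := by
    refine analyticAt_const.mul (AnalyticAt.log ?_ ?_)
    · exact (analyticAt_const.add analyticAt_id).div (analyticAt_const.sub analyticAt_id)
        (by simp; linarith)
    · exact div_pos (by linarith) (by linarith)
  refine h2.congr ?_
  filter_upwards [continuous_abs.continuousAt.eventually_lt continuousAt_const ht] with y hy
  have h3 := abs_lt.1 hy
  exact (Real.artanh_eq_half_log ⟨h3.1.le, h3.2.le⟩).symm

theorem analyticAt_artanhMap (x : E3) : AnalyticAt ℝ artanhMap (tanhMap x) :=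
  analyticAt_toLp fun i =>
    (Real.analyticAt_artanh (Real.abs_tanh_lt_one (x i))).comp_of_eq (analyticAt_coord i _) rfl

theorem eventually_tanhMap_artanhMap (x : E3) :
    ∀ᶠ u in nhds (tanhMap x), tanhMap (artanhMap u) = u := by
  have h : ∀ᶠ u in nhds (tanhMap x), ∀ i, |u i| < 1 := by
    refine Filter.eventually_all.2 fun i => ?_
    exact (continuous_abs.continuousAt.comp (analyticAt_coord i _).continuousAt).eventually_lt
      continuousAt_const (Real.abs_tanh_lt_one (x i))
  filter_upwards [h] with u hu
  ext i
  exact Real.tanh_artanh (abs_lt.1 (hu i))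

theorem ExteriorDomain.nonempty_compl {Ω : Set E3} (hΩ : ExteriorDomain Ω) : Ωᶜ.Nonempty := by
  obtain ⟨x, hx⟩ := hΩ.bdry_nonempty
  rw [hΩ.isOpen.frontier_eq] at hx
  exact ⟨x, hx.2⟩

theorem ExteriorDomain.nonempty {Ω : Set E3} (hΩ : ExteriorDomain Ω) : Ω.Nonempty := by
  obtain ⟨x, hx⟩ := hΩ.bdry_nonempty
  exact closure_nonempty_iff.1 ⟨x, hx.1⟩

theorem sdist_eq_of_mem_closure {Ω : Set E3} {x : E3} (hx : x ∈ closure Ω) :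
    sdist Ω x = Metric.infDist x Ωᶜ := by
  simp [sdist, Metric.infDist_zero_of_mem_closure hx]

theorem ExteriorDomain.sdist_pos {Ω : Set E3} (hΩ : ExteriorDomain Ω) {x : E3} (hx : x ∈ Ω) :
    0 < sdist Ω x := by
  rw [sdist_eq_of_mem_closure (subset_closure hx)]
  exact (hΩ.compl_compact.isClosed.notMem_iff_infDist_pos hΩ.nonempty_compl).1 fun h => h hx

theorem ExteriorDomain.sdist_eq_zero_iff {Ω : Set E3} (hΩ : ExteriorDomain Ω) {x : E3} :
    sdist Ω x = 0 ↔ x ∈ frontier Ω := by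
  rw [hΩ.isOpen.frontier_eq]
  by_cases hx : x ∈ Ω
  · simp [hx, (hΩ.sdist_pos hx).ne']
  by_cases hx' : x ∈ closure Ω
  · simp [hx, hx', sdist, Metric.infDist_zero_of_mem_closure hx', Metric.infDist_zero_of_mem
      (Set.mem_compl hx)]
  · have := (isClosed_closure.notMem_iff_infDist_pos hΩ.nonempty.closure).1 hx'
    rw [Metric.infDist_closure] at this
    simp [hx', sdist, Metric.infDist_zero_of_mem (Set.mem_compl hx), this.ne']

theorem ExteriorDomain.isCompact_frontier {Ω : Set E3} (hΩ : ExteriorDomain Ω) :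
    IsCompact (frontier Ω) :=
  hΩ.compl_compact.of_isClosed_subset isClosed_frontier (by
    rw [hΩ.isOpen.frontier_eq]
    exact fun x hx => hx.2)

theorem tanhMap_mem_closedBox (x : E3) : tanhMap x ∈ closedBox (fun _ => -1) fun _ => 1 :=
  fun i => ⟨(Real.neg_one_lt_tanh (x i)).le, (Real.tanh_lt_one (x i)).le⟩

theorem exists_analytic_sub_inv_sdist {Ω : Set E3} (hΩ : ExteriorDomain Ω)
    (hb : ∀ x ∈ frontier Ω, AnalyticAt ℝ (sdist Ω) x) :
    ∃ m : E3 → ℝ, (∀ x ∈ frontier Ω,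
        AnalyticAt ℝ (fun u => m u - (sdist Ω (artanhMap u))⁻¹) (tanhMap x)) ∧
      ∀ u ∈ closedBox (fun _ => -1) fun _ => 1, u ∉ tanhMap '' frontier Ω → AnalyticAt ℝ m u := by
  classical
  have hQ : IsClosed (tanhMap '' frontier Ω) := (hΩ.isCompact_frontier.image
    (continuous_iff_continuousAt.2 fun x => (analyticAt_tanhMap x).continuousAt)).isClosed
  obtain ⟨m, hm⟩ := cousinSolvable_closedBox (a := fun _ => -1) (b := fun _ => 1)
    (σ := fun q u => if q ∈ tanhMap '' frontier Ω then (sdist Ω (artanhMap u))⁻¹ else 0) (by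
      intro q _
      by_cases hq : q ∈ tanhMap '' frontier Ω
      · obtain ⟨x, hx, rfl⟩ := hq
        have hD : AnalyticAt ℝ (fun u => sdist Ω (artanhMap u)) (tanhMap x) :=
          AnalyticAt.comp_of_eq (hb x hx) (analyticAt_artanhMap x) (artanhMap_tanhMap x)
        filter_upwards [hD.eventually_analyticAt, eventually_tanhMap_artanhMap x] with u hu1 hu2
        by_cases hu : u ∈ tanhMap '' frontier Ω
        · simp only [hu, Set.mem_image_of_mem tanhMap hx, if_true, sub_self]
          exact analyticAt_const
        · simp only [hu, Set.mem_image_of_mem tanhMap hx, if_true, if_false, sub_zero]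
          refine hu1.inv fun h0 => hu ?_
          exact ⟨_, hΩ.sdist_eq_zero_iff.1 h0, hu2⟩
      · filter_upwards [hQ.isOpen_compl.mem_nhds hq] with u hu
        simp only [hq, if_false, if_neg hu, sub_self]
        exact analyticAt_const)
  refine ⟨m, fun x hx => ?_, fun u hu huQ => ?_⟩
  · simpa only [Set.mem_image_of_mem tanhMap hx, if_true] using
      hm _ (tanhMap_mem_closedBox x)
  · simpa only [huQ, if_false, sub_zero] using hm u hu

theorem exists_analytic_definingFunction {Ω : Set E3} (hΩ : ExteriorDomain Ω)
    (hb : ∀ x ∈ frontier Ω, AnalyticAt ℝ (sdist Ω) x) :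
    ∃ (f : E3 → ℝ) (K : Set E3), IsCompact K ∧ AnalyticOnNhd ℝ f K ∧
      (∀ x ∈ closure Ω, tanhMap x ∈ K) ∧
      ∀ x ∈ frontier Ω, ∃ w : E3 → ℝ, AnalyticAt ℝ w x ∧ w x = 1 ∧
        (fun y => f (tanhMap y)) =ᶠ[nhds x] fun y => sdist Ω y * w y := by
  classical
  obtain ⟨m, hmQ, hm⟩ := exists_analytic_sub_inv_sdist hΩ hb
  have hcont : Continuous tanhMap :=
    continuous_iff_continuousAt.2 fun x => (analyticAt_tanhMap x).continuousAt
  set Q := tanhMap '' frontier Ω with hQdef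
  have hQ : IsClosed Q := (hΩ.isCompact_frontier.image hcont).isClosed
  set B := closedBox (fun _ => -1) fun _ => 1
  have hB : IsCompact B := isCompact_closedBox _ _
  have hDan : ∀ x ∈ frontier Ω, AnalyticAt ℝ (fun u => sdist Ω (artanhMap u)) (tanhMap x) :=
    fun x hx => AnalyticAt.comp_of_eq (hb x hx) (analyticAt_artanhMap x) (artanhMap_tanhMap x)
  have hlow : ∃ c, ∀ x ∈ Ω, tanhMap x ∈ B → c ≤ m (tanhMap x) := by
    refine hB.induction_on (p := fun s => ∃ c, ∀ x ∈ Ω, tanhMap x ∈ s → c ≤ m (tanhMap x))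
      ⟨0, by simp⟩ ?_ ?_ ?_
    · rintro s t hst ⟨c, hc⟩
      exact ⟨c, fun x hx hxs => hc x hx (hst hxs)⟩
    · rintro s t ⟨c, hc⟩ ⟨c', hc'⟩
      refine ⟨min c c', fun x hx hxs => ?_⟩
      rcases hxs with h | h
      · exact (min_le_left _ _).trans (hc x hx h)
      · exact (min_le_right _ _).trans (hc' x hx h)
    · intro q hq
      by_cases hqQ : q ∈ Q
      · obtain ⟨p, hp, rfl⟩ := hqQ
        refine ⟨_, mem_nhdsWithin_of_mem_nhds ((hmQ p hp).continuousAt.eventually_const_lt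
          (sub_one_lt _)), m (tanhMap p) - (sdist Ω (artanhMap (tanhMap p)))⁻¹ - 1,
          fun x hx hxs => ?_⟩
        have h1 : m (tanhMap p) - (sdist Ω (artanhMap (tanhMap p)))⁻¹ - 1 <
          m (tanhMap x) - (sdist Ω (artanhMap (tanhMap x)))⁻¹ := hxs
        rw [artanhMap_tanhMap x] at h1
        have h2 := inv_pos.2 (hΩ.sdist_pos hx)
        exact h1.le.trans (sub_le_self _ h2.le)
      · exact ⟨_, mem_nhdsWithin_of_mem_nhds ((hm q hq hqQ).continuousAt.eventually_const_lt
          (sub_one_lt _)), _, fun x _ hxs => le_of_lt hxs⟩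
  obtain ⟨c, hc⟩ := hlow
  have hc : ∀ x ∈ Ω, c ≤ m (tanhMap x) := fun x hx => hc x hx (tanhMap_mem_closedBox x)
  have hmain : ∀ p ∈ frontier Ω, ∃ a : E3 → ℝ, AnalyticAt ℝ a (tanhMap p) ∧ a (tanhMap p) = 1 ∧
      (fun u => if u ∈ Q then 0 else (m u - c + 1)⁻¹) =ᶠ[nhds (tanhMap p)]
        fun u => sdist Ω (artanhMap u) * a u := by
    intro p hp
    have h0 : sdist Ω (artanhMap (tanhMap p)) = 0 := by
      rw [artanhMap_tanhMap, hΩ.sdist_eq_zero_iff.2 hp]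
    refine ⟨fun u => (1 + sdist Ω (artanhMap u) * (m u - (sdist Ω (artanhMap u))⁻¹ - c + 1))⁻¹,
      ?_, ?_, ?_⟩
    · refine AnalyticAt.inv (analyticAt_const.add ((hDan p hp).mul
        (((hmQ p hp).sub analyticAt_const).add analyticAt_const))) ?_
      simp [h0]
    · simp [h0]
    · filter_upwards [eventually_tanhMap_artanhMap p] with u hu
      by_cases huQ : u ∈ Q
      · obtain ⟨x, hx, rfl⟩ := huQ
        have h1 : tanhMap x ∈ Q := Set.mem_image_of_mem _ hx
        simp [h1, artanhMap_tanhMap, hΩ.sdist_eq_zero_iff.2 hx]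
      · have h1 : sdist Ω (artanhMap u) ≠ 0 := fun h =>
          huQ ⟨_, hΩ.sdist_eq_zero_iff.1 h, hu⟩
        simp only [if_neg huQ]
        have h2 : 1 + sdist Ω (artanhMap u) * (m u - (sdist Ω (artanhMap u))⁻¹ - c + 1) =
            sdist Ω (artanhMap u) * (m u - c + 1) := by
          field_simp
          ring
        rw [h2, mul_inv, mul_inv_cancel_left₀ h1]
  have hK : closure (tanhMap '' Ω) ⊆ B :=
    hB.isClosed.closure_subset_iff.2 (Set.image_subset_iff.2 fun x _ => tanhMap_mem_closedBox x)
  refine ⟨fun u => if u ∈ Q then 0 else (m u - c + 1)⁻¹, closure (tanhMap '' Ω),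
    hB.of_isClosed_subset isClosed_closure hK, fun q hq => ?_,
    fun x hx => map_mem_closure hcont hx fun y hy => Set.mem_image_of_mem _ hy, fun p hp => ?_⟩
  · by_cases hqQ : q ∈ Q
    · obtain ⟨p, hp, rfl⟩ := hqQ
      obtain ⟨a, ha, -, hfa⟩ := hmain p hp
      exact ((hDan p hp).mul ha).congr hfa.symm
    · have h1 := hm q (hK hq) hqQ
      have h2 : c ≤ m q := by
        by_contra! h
        obtain ⟨_, hu, x, hx, rfl⟩ :=
          mem_closure_iff_nhds.1 hq _ (h1.continuousAt.eventually_lt_const h)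
        exact absurd (hc x hx) (not_le.2 hu)
      refine (((h1.sub analyticAt_const).add analyticAt_const).inv
        (ne_of_gt (a := m q - c + 1) (by linarith))).congr ?_
      filter_upwards [hQ.isOpen_compl.mem_nhds hqQ] with u hu
      simp only [if_neg hu]
      rfl
  · obtain ⟨a, ha, ha1, hfa⟩ := hmain p hp
    refine ⟨fun y => a (tanhMap y), ha.comp (analyticAt_tanhMap p), ha1, ?_⟩
    filter_upwards [hcont.continuousAt.eventually hfa] with y hy
    rw [hy, artanhMap_tanhMap]

theorem pd_const_mul (i : Fin 3) (s : ℝ) (f : E3 → ℝ) :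
    pd i (fun x => s * f x) = fun x => s * pd i f x := by
  have h1 : (fun x => s * f x) = s • f := rfl
  have h2 := fderiv_const_smul_field (𝕜 := ℝ) (f := f) s
  funext x
  simp [pd, h1, h2]

theorem pdList_const_mul (l : List (Fin 3)) (s : ℝ) (f : E3 → ℝ) :
    pdList l (fun x => s * f x) = fun x => s * pdList l f x := by
  induction l with
  | nil => rfl
  | cons i l ih => rw [pdList, ih, pd_const_mul]; rfl

theorem AnalyticAt.pd {f : E3 → ℝ} {x : E3} (hf : AnalyticAt ℝ f x) (i : Fin 3) :
    AnalyticAt ℝ (pd i f) x :=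
  ((ContinuousLinearMap.apply ℝ ℝ (EuclideanSpace.single i 1 : E3)).analyticAt _).comp hf.fderiv

theorem pd_mul {f g : E3 → ℝ} {x : E3} (hf : DifferentiableAt ℝ f x) (hg : DifferentiableAt ℝ g x)
    (i : Fin 3) : pd i (fun y => f y * g y) x = f x * pd i g x + g x * pd i f x := by
  simp only [pd]
  rw [fderiv_fun_mul hf hg]
  simp

/-- The coefficients of the field `e_j × ∇φ`. -/
def rotCoeff (φ : E3 → ℝ) (j i : Fin 3) : E3 → ℝ := fun x =>
  (!![0, -1, 1; 1, 0, -1; -1, 1, 0] : Matrix (Fin 3) (Fin 3) ℝ) j i *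
    pd ((!![0, 2, 1; 2, 1, 0; 1, 0, 2] : Matrix (Fin 3) (Fin 3) (Fin 3)) j i) φ x

theorem vecOp_rotCoeff_eq_zero {φ d : E3 → ℝ} {x : E3} (h : ∀ i, pd i φ x = pd i d x)
    (j : Fin 3) : vecOp (rotCoeff φ j) d x = 0 := by
  fin_cases j <;> simp [vecOp, rotCoeff, Fin.sum_univ_three, h] <;> ring

theorem pd_eq_of_sum_sq_ne_zero {φ : E3 → ℝ} {x : E3} (h : ∑ i, pd i φ x ^ 2 ≠ 0) (k : Fin 3)
    (f : E3 → ℝ) : pd k f x = pd k φ x / (∑ i, pd i φ x ^ 2) * vecOp (fun i => pd i φ) f x +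
      ∑ j, -rotCoeff φ k j x / (∑ i, pd i φ x ^ 2) * vecOp (rotCoeff φ j) f x := by
  simp only [Fin.sum_univ_three] at h ⊢
  fin_cases k <;> simp [vecOp, rotCoeff, Fin.sum_univ_three] <;> field_simp <;> ring

theorem factorial_bound {C : ℝ} (hC : 0 < C) (n : ℕ) :
    C ^ (n + 1 + 1) * (Nat.factorial (n + 1) : ℝ) ≤
      (2 * C * (C + 1)) ^ (n + 1) * (Nat.factorial n : ℝ) := by
  have h1 : ((n : ℝ) + 1) ≤ 2 ^ (n + 1) := by
    exact_mod_cast (Nat.lt_two_pow_self (n := n + 1)).le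
  have h2 : C ≤ (C + 1) ^ (n + 1) :=
    (le_add_of_nonneg_right zero_le_one).trans (le_self_pow₀ (by linarith) (by simp))
  rw [Nat.factorial_succ, mul_pow, mul_pow, pow_succ C (n + 1)]
  push_cast
  calc C ^ (n + 1) * C * (((n : ℝ) + 1) * (Nat.factorial n : ℝ))
      ≤ C ^ (n + 1) * (C + 1) ^ (n + 1) * (2 ^ (n + 1) * (Nat.factorial n : ℝ)) := by gcongr
    _ = _ := by ring

theorem ExteriorDomain.exists_collar_subset {Ω V : Set E3} (hΩ : ExteriorDomain Ω) (hV : IsOpen V)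
    (hVΩ : frontier Ω ⊆ V) : ∃ η > 0, ∀ x ∈ closure Ω, sdist Ω x ≤ η → x ∈ V := by
  obtain ⟨δ, hδ, H⟩ := hΩ.compl_compact.exists_thickening_subset_open
    (hV.union isClosed_closure.isOpen_compl) (fun x hx => by
      by_cases h : x ∈ closure Ω
      · exact Or.inl (hVΩ (hΩ.isOpen.frontier_eq ▸ ⟨h, hx⟩))
      · exact Or.inr h)
  refine ⟨δ / 2, half_pos hδ, fun x hx hxd => ?_⟩
  rw [sdist_eq_of_mem_closure hx] at hxd
  have : x ∈ Metric.thickening δ Ωᶜ :=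
    (Metric.mem_thickening_iff_infDist_lt hΩ.nonempty_compl).2 (by linarith)
  exact (H this).resolve_right fun h => h hx

/-- Theorem 3.1, construction of tangential analytic fields.
For an exterior domain `Ω ⊆ ℝ³` with real-analytic boundary there exist
analytic vector fields `X₀, T₁, T₂, T₃` on the closure of `Ω` such that the
`T_j` are tangential to `∂Ω`, their coefficients satisfy uniform analyticity
bounds `|∂^α b_{ij}| ≤ C^{|α|+1} |α|!` on the closure of `Ω`, and near the
boundary the fields `X₀, T₁, T₂, T₃` span all partial derivatives with
real-analytic coefficients. -/
theorem stmt0 (Ω : Set E3) (hΩ : ExteriorDomain Ω) (hb : AnalyticBoundary Ω) :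
    ∃ (bX : Fin 3 → E3 → ℝ) (b : Fin 3 → Fin 3 → E3 → ℝ) (C : ℝ), 0 < C ∧
      (∀ j i : Fin 3, ∀ l : List (Fin 3), ∀ x ∈ closure Ω,
        |pdList l (b j i) x| ≤ C ^ (l.length + 1) * (Nat.factorial l.length : ℝ)) ∧
      (∀ i : Fin 3, ∀ l : List (Fin 3), ∀ x ∈ closure Ω,
        |pdList l (bX i) x| ≤ C ^ (l.length + 1) * (Nat.factorial l.length : ℝ)) ∧
      (∀ i : Fin 3, AnalyticOnNhd ℝ (bX i) (closure Ω)) ∧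
      (∀ j i : Fin 3, AnalyticOnNhd ℝ (b j i) (closure Ω)) ∧
      (∀ j : Fin 3, ∀ x ∈ frontier Ω, vecOp (b j) (sdist Ω) x = 0) ∧
      ∃ η₀ : ℝ, 0 < η₀ ∧
        ∃ (ξ : Fin 3 → E3 → ℝ) (ηc : Fin 3 → Fin 3 → E3 → ℝ),
          (∀ k : Fin 3,
            AnalyticOnNhd ℝ (ξ k) {x | x ∈ closure Ω ∧ sdist Ω x ≤ η₀}) ∧
          (∀ j k : Fin 3,
            AnalyticOnNhd ℝ (ηc j k) {x | x ∈ closure Ω ∧ sdist Ω x ≤ η₀}) ∧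
          ∀ k : Fin 3, ∀ f : E3 → ℝ, Differentiable ℝ f →
            ∀ x ∈ closure Ω, sdist Ω x ≤ η₀ →
              pd k f x = ξ k x * vecOp bX f x + ∑ j, ηc j k x * vecOp (b j) f x := by

  obtain ⟨U, -, hU, hUan, hgrad⟩ := hb
  obtain ⟨f, K, hK, hf, hKΩ, hfr⟩ :=
    exists_analytic_definingFunction hΩ fun x hx => hUan x (hU hx)
  obtain ⟨C, hC, hbound⟩ := hK.exists_pdList_comp_tanhMap_le hf
  set φ : E3 → ℝ := fun y => f (tanhMap y) with hφdef
  have hφ : ∀ x ∈ closure Ω, AnalyticAt ℝ φ x := fun x hx =>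
    (hf _ (hKΩ x hx)).comp (analyticAt_tanhMap x)
  have hφd : ∀ x ∈ frontier Ω, ∀ i, pd i φ x = pd i (sdist Ω) x := fun x hx i => by
    obtain ⟨w, hw, hw1, hφw⟩ := hfr x hx
    rw [pd, hφw.fderiv_eq]
    refine (pd_mul (hUan x (hU hx)).differentiableAt hw.differentiableAt i).trans ?_
    simp [hw1, hΩ.sdist_eq_zero_iff.2 hx]
  have hpd : ∀ i (l : List (Fin 3)), ∀ x ∈ closure Ω, |pdList l (pd i φ) x| ≤
      (2 * C * (C + 1)) ^ (l.length + 1) * (Nat.factorial l.length : ℝ) := fun i l x hx => by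
    have h1 := hbound (l ++ [i]) x (hKΩ x hx)
    rw [pdList_append, List.length_append, List.length_singleton] at h1
    exact h1.trans (factorial_bound hC _)
  have hrot : ∀ j i, ∀ x ∈ closure Ω, AnalyticAt ℝ (rotCoeff φ j i) x := fun j i x hx =>
    analyticAt_const.mul ((hφ x hx).pd _)
  have hsq : ∀ x ∈ closure Ω, AnalyticAt ℝ (fun y => ∑ i, pd i φ y ^ 2) x := fun x hx =>
    Finset.analyticAt_fun_sum _ fun i _ => ((hφ x hx).pd i).pow 2
  obtain ⟨η, hη, hcollar⟩ := hΩ.exists_collar_subset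
    (isOpen_interior (s := {x | ∑ i, pd i φ x ^ 2 ≠ 0})) fun x hx => by
      refine mem_interior_iff_mem_nhds.2 ((hsq x hx.1).continuousAt.eventually_ne fun h0 => ?_)
      obtain ⟨i, hi⟩ := hgrad x hx
      rw [Finset.sum_eq_zero_iff_of_nonneg fun _ _ => sq_nonneg _] at h0
      have := h0 i (mem_univ i)
      rw [sq_eq_zero_iff, hφd x hx] at this
      exact hi this
  have hne : ∀ x ∈ closure Ω, sdist Ω x ≤ η → ∑ i, pd i φ x ^ 2 ≠ 0 := fun x hx hxη =>
    interior_subset (hcollar x hx hxη)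
  refine ⟨fun i => pd i φ, rotCoeff φ, 2 * C * (C + 1), by positivity, fun j i l x hx => ?_, hpd,
    fun i x hx => (hφ x hx).pd i, hrot, fun j x hx => vecOp_rotCoeff_eq_zero (hφd x hx) j,
    η, hη, fun k x => pd k φ x / ∑ i, pd i φ x ^ 2,
    fun j k x => -rotCoeff φ k j x / ∑ i, pd i φ x ^ 2,
    fun k x hx => ((hφ x hx.1).pd k).div (hsq x hx.1) (hne x hx.1 hx.2),
    fun j k x hx => (hrot k j x hx.1).neg.div (hsq x hx.1) (hne x hx.1 hx.2),
    fun k g _ x hx hxη => pd_eq_of_sum_sq_ne_zero (hne x hx hxη) k g⟩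
  unfold rotCoeff
  rw [pdList_const_mul, abs_mul]
  refine (mul_le_of_le_one_left (abs_nonneg _) ?_).trans (hpd _ l x hx)
  fin_cases j <;> fin_cases i <;> simp


end
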